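/- There exist absolute constants C > 0 and c ≥ 1 with the following property. For every finite simple connected graph G on vertex set V with n vertices and minimum degree δ ≥ 1, the number of unordered partitions {S, V∖S} of V with |S| ≥ 2, |V∖S| ≥ 2, and 2·|∂S| < 3·λ(G) is at most C·(n/δ)²·(log(n+2))^c. -/

import Mathlib

open scoped Classical
open Finset

noncomputable section

variable {V : Type*} [Fintype V]

/-- The set of edges of `G` with exactly one endpoint in `S`. -/
def bdry (G : SimpleGraph V) (S : Finset V) : Finset (Sym2 V) :=
  G.edgeFinset.filter fun e => ∃ u v, u ∈ S ∧ v ∉ S ∧ e = s(u, v)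

/-- The edge connectivity of `G`: the minimum of `|∂S|` over nonempty proper `S ⊆ V`. -/
def econn (G : SimpleGraph V) : ℕ :=
  sInf {k | ∃ S : Finset V, S.Nonempty ∧ S ≠ Finset.univ ∧ (bdry G S).card = k}

/-- Twice the total weight of the pairs separated by `S`, when `w` is symmetric. -/
def cutWeight {W : Type*} [Fintype W] (w : W → W → ℕ) (S : Finset W) : ℕ :=
  ∑ u, ∑ v, w u v * if (u ∈ S ↔ v ∈ S) then 0 else 1

lemma card_mul_cutWeight_add_sum_le {W ι : Type*} [Fintype W] (w : W → W → ℕ) (z : Finset W)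
    (I : Finset ι) (P : ι → Finset W)
    (hP : ∀ i ∈ I, ∀ j ∈ I, ∀ u, u ∈ P i → u ∈ P j → i = j) :
    I.card * cutWeight w z + ∑ i ∈ I, cutWeight w (P i) ≤
      ∑ i ∈ I, cutWeight w (symmDiff z (P i)) + 4 * cutWeight w z := by
  have hone : ∀ u, ∑ i ∈ I, (if u ∈ P i then 1 else 0) ≤ 1 := by
    intro u
    rw [Finset.sum_boole]
    simp only [Nat.cast_id]
    rw [Finset.card_le_one]
    intro i hi j hj
    simp only [Finset.mem_filter] at hi hj
    exact hP i hi.1 j hj.1 u hi.2 hj.2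
  have hpt : ∀ u v, I.card * (if (u ∈ z ↔ v ∈ z) then 0 else 1)
      + ∑ i ∈ I, (if (u ∈ P i ↔ v ∈ P i) then 0 else 1)
      ≤ ∑ i ∈ I, (if (u ∈ symmDiff z (P i) ↔ v ∈ symmDiff z (P i)) then 0 else 1)
        + 4 * (if (u ∈ z ↔ v ∈ z) then 0 else 1) := by
    intro u v
    by_cases h : (u ∈ z ↔ v ∈ z)
    · simp only [h, if_true, mul_zero, zero_add, add_zero]
      apply Finset.sum_le_sum
      intro i _
      simp only [Finset.mem_symmDiff]
      split_ifs <;> tauto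
    · simp only [h, if_false, mul_one]
      have h1 : ∑ i ∈ I, (if (u ∈ P i ↔ v ∈ P i) then 0 else 1) ≤ 2 := by
        calc _ ≤ ∑ i ∈ I, ((if u ∈ P i then 1 else 0) + (if v ∈ P i then 1 else 0)) := by
              apply Finset.sum_le_sum
              intro i _
              split_ifs <;> first | omega | tauto
          _ ≤ 2 := by
              rw [Finset.sum_add_distrib]
              have := hone u
              have := hone v
              omega
      have h2 : I.card = ∑ i ∈ I, (if (u ∈ P i ↔ v ∈ P i) then 0 else 1) +
          ∑ i ∈ I, (if (u ∈ symmDiff z (P i) ↔ v ∈ symmDiff z (P i)) then 0 else 1) := by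
        rw [← Finset.sum_add_distrib, Finset.card_eq_sum_ones]
        apply Finset.sum_congr rfl
        intro i _
        simp only [Finset.mem_symmDiff]
        split_ifs <;> first | omega | tauto
      omega
  have key : ∑ u, ∑ v, w u v * (I.card * (if (u ∈ z ↔ v ∈ z) then 0 else 1)
      + ∑ i ∈ I, (if (u ∈ P i ↔ v ∈ P i) then 0 else 1)) ≤
      ∑ u, ∑ v, w u v *
        (∑ i ∈ I, (if (u ∈ symmDiff z (P i) ↔ v ∈ symmDiff z (P i)) then 0 else 1)
        + 4 * (if (u ∈ z ↔ v ∈ z) then 0 else 1)) :=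
    Finset.sum_le_sum fun u _ => Finset.sum_le_sum fun v _ => Nat.mul_le_mul_left _ (hpt u v)
  have hswap : ∀ Q : ι → Finset W, ∑ i ∈ I, cutWeight w (Q i) =
      ∑ u, ∑ v, w u v * ∑ i ∈ I, (if (u ∈ Q i ↔ v ∈ Q i) then 0 else 1) := by
    intro Q
    simp only [cutWeight, Finset.mul_sum]
    rw [Finset.sum_comm]
    apply Finset.sum_congr rfl
    intro u _
    rw [Finset.sum_comm]
  have hscale : ∀ m : ℕ, m * cutWeight w z =
      ∑ u, ∑ v, w u v * (m * (if (u ∈ z ↔ v ∈ z) then 0 else 1)) := by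
    intro m
    simp only [cutWeight, Finset.mul_sum]
    refine Finset.sum_congr rfl fun u _ => Finset.sum_congr rfl fun v _ => by ring
  rw [hswap P, hswap (fun i => symmDiff z (P i)), hscale, hscale]
  simpa only [mul_add, Finset.sum_add_distrib] using key

/-- A rooted tree, given by its parent map; `rank` increases away from the root. -/
structure ParentTree (W : Type*) where
  root : W
  parent : W → W
  rank : W → ℕ
  parent_root : parent root = root
  rank_parent_lt : ∀ v, v ≠ root → rank (parent v) < rank v

namespace ParentTree

variable {W : Type*} (T : ParentTree W)

/-- `T.Below u v`: the vertex `u` lies in the subtree hanging from `v`. -/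
def Below (u v : W) : Prop := ∃ k : ℕ, T.parent^[k] u = v

lemma Below.refl (u : W) : T.Below u u := ⟨0, rfl⟩

variable {T}

lemma Below.trans {u v x : W} (h : T.Below u v) (h' : T.Below v x) : T.Below u x := by
  obtain ⟨k, rfl⟩ := h
  obtain ⟨l, rfl⟩ := h'
  exact ⟨l + k, Function.iterate_add_apply _ _ _ _⟩

lemma Below.total {u v x : W} (h : T.Below u v) (h' : T.Below u x) :
    T.Below v x ∨ T.Below x v := by
  obtain ⟨k, rfl⟩ := h
  obtain ⟨l, rfl⟩ := h'
  rcases le_total k l with hkl | hkl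
  · left
    exact ⟨l - k, by rw [← Function.iterate_add_apply, Nat.sub_add_cancel hkl]⟩
  · right
    exact ⟨k - l, by rw [← Function.iterate_add_apply, Nat.sub_add_cancel hkl]⟩

lemma below_root {v : W} : T.Below T.root v ↔ v = T.root := by
  constructor
  · rintro ⟨k, rfl⟩
    exact Function.iterate_fixed T.parent_root k
  · rintro rfl
    exact Below.refl T _

lemma rank_iterate (u : W) (k : ℕ) :
    T.parent^[k] u = u ∨ T.rank (T.parent^[k] u) < T.rank u := by
  induction k with
  | zero => left; rfl
  | succ k ih =>
    rw [Function.iterate_succ_apply']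
    by_cases h : T.parent^[k] u = T.root
    · rw [h, T.parent_root, ← h]
      exact ih
    · have := T.rank_parent_lt _ h
      rcases ih with ih | ih
      · rw [ih] at this ⊢
        exact Or.inr this
      · exact Or.inr (this.trans ih)

lemma Below.rank_lt {u v : W} (h : T.Below u v) (hne : u ≠ v) : T.rank v < T.rank u := by
  obtain ⟨k, rfl⟩ := h
  rcases T.rank_iterate u k with h | h
  · exact absurd h.symm hne
  · exact h

lemma Below.antisymm {u v : W} (h : T.Below u v) (h' : T.Below v u) : u = v := by
  by_contra hne
  have := h.rank_lt hne
  have := h'.rank_lt (Ne.symm hne)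
  omega

lemma below_iff_parent {u v : W} : T.Below u v ↔ u = v ∨ T.Below (T.parent u) v := by
  constructor
  · rintro ⟨k, rfl⟩
    cases k with
    | zero => exact Or.inl rfl
    | succ k => exact Or.inr ⟨k, rfl⟩
  · rintro (rfl | ⟨k, rfl⟩)
    · exact Below.refl T _
    · exact ⟨k + 1, rfl⟩

lemma not_below_parent {v : W} (hv : v ≠ T.root) : ¬ T.Below (T.parent v) v := by
  intro h
  have h1 := T.rank_parent_lt v hv
  by_cases h2 : T.parent v = v
  · rw [h2] at h1; omega
  · have := h.rank_lt h2
    omega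

variable [Fintype W] (T)

/-- The vertex set of the subtree hanging from `v`. -/
def subtree (v : W) : Finset W := Finset.univ.filter fun u => T.Below u v

/-- The tree edges crossing `S`, each represented by its lower endpoint. -/
def crossing (S : Finset W) : Finset W :=
  Finset.univ.filter fun v => v ≠ T.root ∧ ¬ (T.parent v ∈ S ↔ v ∈ S)

variable {T}

@[simp] lemma mem_subtree {u v : W} : u ∈ T.subtree v ↔ T.Below u v := by
  simp [subtree]

lemma mem_crossing {S : Finset W} {v : W} :
    v ∈ T.crossing S ↔ v ≠ T.root ∧ ¬ (T.parent v ∈ S ↔ v ∈ S) := by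
  simp [crossing]

lemma crossing_injective {S S' : Finset W} (hS : T.root ∉ S) (hS' : T.root ∉ S')
    (h : T.crossing S = T.crossing S') : S = S' := by
  have key : ∀ n, ∀ v, T.rank v = n → (v ∈ S ↔ v ∈ S') := by
    intro n
    induction n using Nat.strong_induction_on with
    | _ n ih =>
      intro v hv
      by_cases hr : v = T.root
      · subst hr; simp [hS, hS']
      · have h1 := ih _ (hv ▸ T.rank_parent_lt v hr) (T.parent v) rfl
        have h2 : v ∈ T.crossing S ↔ v ∈ T.crossing S' := by rw [h]
        rw [mem_crossing, mem_crossing] at h2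
        tauto
  ext v
  exact key _ v rfl

lemma crossing_symmDiff (S S' : Finset W) :
    T.crossing (symmDiff S S') = symmDiff (T.crossing S) (T.crossing S') := by
  ext v
  simp only [Finset.mem_symmDiff, mem_crossing]
  tauto

lemma crossing_subtree {c : W} (hc : c ≠ T.root) : T.crossing (T.subtree c) = {c} := by
  ext v
  rw [mem_crossing, mem_subtree, mem_subtree, Finset.mem_singleton]
  constructor
  · rintro ⟨hv, h⟩
    by_contra hne
    apply h
    rw [below_iff_parent (u := v)]
    tauto
  · rintro rfl
    have := T.not_below_parent hc
    have := Below.refl T v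
    tauto

lemma root_notMem_subtree {c : W} (hc : c ≠ T.root) : T.root ∉ T.subtree c := by
  rw [mem_subtree, below_root]
  exact hc

lemma root_notMem_crossing (S : Finset W) : T.root ∉ T.crossing S := by
  simp [mem_crossing]

lemma crossing_nonempty {S : Finset W} (hS : T.root ∉ S) (hne : S.Nonempty) :
    (T.crossing S).Nonempty := by
  rw [Finset.nonempty_iff_ne_empty] at hne ⊢
  intro h
  apply hne
  apply T.crossing_injective hS (Finset.notMem_empty _)
  rw [h]
  ext v
  simp [mem_crossing]

section lines

variable {W : Type*} [Fintype W] {T : ParentTree W}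

variable (T) in
/-- The vertices `c ∉ p` for which `insert c p` is the crossing set of a member of `F`. -/
def line (F : Finset (Finset W)) (p : Finset W) : Finset W :=
  Finset.univ.filter fun c => c ∉ p ∧ ∃ S ∈ F, T.crossing S = insert c p

lemma mem_line {F : Finset (Finset W)} {p : Finset W} {c : W} :
    c ∈ T.line F p ↔ c ∉ p ∧ ∃ S ∈ F, T.crossing S = insert c p := by
  simp [line]

lemma ne_root_of_mem_line {F : Finset (Finset W)} {p : Finset W} {c : W}
    (h : c ∈ T.line F p) : c ≠ T.root := by
  rintro rfl
  obtain ⟨-, S, -, hS⟩ := mem_line.1 h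
  exact T.root_notMem_crossing S (hS ▸ Finset.mem_insert_self _ _)

variable {w : W → W → ℕ} {L : ℕ} {F : Finset (Finset W)}

lemma card_antichain_le
    (hL : ∀ S : Finset W, S.Nonempty → S ≠ Finset.univ → L ≤ cutWeight w S)
    (hr : ∀ S ∈ F, T.root ∉ S) (hlt : ∀ S ∈ F, 2 * cutWeight w S < 3 * L)
    {p A : Finset W} (hp : p.Nonempty) (hA : A ⊆ T.line F p)
    (hanti : ∀ c ∈ A, ∀ c' ∈ A, T.Below c c' → c = c') : A.card ≤ 7 := by
  by_contra hcard
  obtain ⟨B, hBA, hB⟩ := Finset.exists_subset_card_eq (show 8 ≤ A.card by omega)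
  obtain ⟨c₀, hc₀⟩ : B.Nonempty := by rw [← Finset.card_pos]; omega
  have hroot : ∀ c ∈ B, c ≠ T.root := fun c hc => ne_root_of_mem_line (hA (hBA hc))
  obtain ⟨hc₀p, S₀, hS₀, hTS₀⟩ := mem_line.1 (hA (hBA hc₀))
  set z := symmDiff S₀ (T.subtree c₀) with hz
  have hTz : T.crossing z = p := by
    rw [hz, crossing_symmDiff, crossing_subtree (hroot _ hc₀), hTS₀]
    ext v
    simp only [Finset.mem_symmDiff, Finset.mem_insert, Finset.mem_singleton]
    by_cases hv : v = c₀
    · subst hv; tauto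
    · tauto
  have hrz : T.root ∉ z := by
    rw [hz, Finset.mem_symmDiff]
    have := hr _ hS₀
    have := T.root_notMem_subtree (hroot _ hc₀)
    tauto
  have hzL : L ≤ cutWeight w z := by
    apply hL
    · rw [Finset.nonempty_iff_ne_empty]
      intro h
      obtain ⟨v, hv⟩ := hp
      rw [← hTz, h] at hv
      simp [mem_crossing] at hv
    · intro h
      rw [h] at hrz
      exact hrz (Finset.mem_univ _)
  have hmem : ∀ c ∈ B, symmDiff z (T.subtree c) ∈ F := by
    intro c hc
    obtain ⟨hcp, S, hS, hTS⟩ := mem_line.1 (hA (hBA hc))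
    have : symmDiff z (T.subtree c) = S := by
      apply T.crossing_injective _ (hr _ hS)
      · rw [crossing_symmDiff, hTz, crossing_subtree (hroot _ hc), hTS]
        ext v
        simp only [Finset.mem_symmDiff, Finset.mem_insert, Finset.mem_singleton]
        by_cases hv : v = c
        · subst hv; tauto
        · tauto
      · rw [Finset.mem_symmDiff]
        have := T.root_notMem_subtree (hroot _ hc)
        tauto
    exact this ▸ hS
  have key := card_mul_cutWeight_add_sum_le w z B T.subtree (by
    intro c hc c' hc' u hu hu'
    rw [mem_subtree] at hu hu'
    rcases hu.total hu' with h | h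
    · exact hanti c (hBA hc) c' (hBA hc') h
    · exact (hanti c' (hBA hc') c (hBA hc) h).symm)
  have h1 : B.card * L ≤ ∑ c ∈ B, cutWeight w (T.subtree c) := by
    rw [← smul_eq_mul]
    apply Finset.card_nsmul_le_sum
    intro c hc
    apply hL
    · exact ⟨c, mem_subtree.2 (Below.refl T c)⟩
    · intro h
      exact T.root_notMem_subtree (hroot _ hc) (h ▸ Finset.mem_univ _)
  have h2 : ∑ c ∈ B, 2 * cutWeight w (symmDiff z (T.subtree c)) < ∑ c ∈ B, 3 * L :=
    Finset.sum_lt_sum_of_nonempty ⟨c₀, hc₀⟩ fun c hc => hlt _ (hmem c hc)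
  rw [← Finset.mul_sum, Finset.sum_const, smul_eq_mul] at h2
  rw [hB] at *
  omega

variable (T) in
/-- `c` can be moved up along its line without passing an element of `p`
and at most halfway towards any element of `p` above it. -/
def UpGood (F : Finset (Finset W)) (p : Finset W) (c : W) : Prop :=
  ∃ c' ∈ T.line F p, c' ≠ c ∧ T.Below c c' ∧ ∀ e ∈ p,
    (T.Below e c' → T.Below e c) ∧ (T.Below c e → T.rank c + T.rank e ≤ 2 * T.rank c')

variable (T) in
/-- `c` can be moved down along its line, keeping below it every element `e` of `p`
which is below it, and going at most halfway towards `e`. -/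
def DownGood (F : Finset (Finset W)) (p : Finset W) (c : W) : Prop :=
  ∃ c' ∈ T.line F p, c' ≠ c ∧ T.Below c' c ∧ ∀ e ∈ p,
    T.Below e c → T.Below e c' ∧ 2 * T.rank c' ≤ T.rank c + T.rank e

variable (T) in
/-- The potential controlling upward moves. -/
def upPotential (e c : W) : ℕ :=
  if T.Below e c then 0 else if T.Below c e then 2 + Nat.log 2 (T.rank c - T.rank e) else 1

variable (T) in
/-- The potential controlling downward moves. -/
def downPotential (e c : W) : ℕ :=
  if T.Below e c then 1 + Nat.log 2 (T.rank e - T.rank c) else 0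

lemma lt_two_mul_of_log_eq {a b : ℕ} (hb : b ≠ 0) (h : Nat.log 2 a = Nat.log 2 b) :
    a < 2 * b := by
  have h1 := Nat.lt_pow_succ_log_self (b := 2) (by norm_num) a
  have h2 := Nat.pow_log_le_self 2 hb
  rw [h, pow_succ] at h1
  omega

lemma upPotential_mono {U : Type*} {T : ParentTree U} {e c c' : U} (h : T.Below c c') (hne : c ≠ c') (hc : c ≠ e) (hc' : c' ≠ e) :
    T.upPotential e c' ≤ T.upPotential e c ∧ (T.upPotential e c' = T.upPotential e c →
      (T.Below e c' → T.Below e c) ∧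
        (T.Below c e → T.rank c + T.rank e ≤ 2 * T.rank c')) := by
  unfold upPotential
  have hlt := h.rank_lt hne
  by_cases h1 : T.Below e c
  · have h2 := h1.trans h
    simp only [h1, h2, if_true, le_refl, true_and, implies_true]
    intro _ h3
    exact absurd (h3.antisymm h1) hc
  · by_cases h3 : T.Below c e
    · rcases h.total h3 with h4 | h4
      · have h5 : ¬ T.Below e c' := fun h5 => hc' (h4.antisymm h5)
        simp only [h1, h5, h3, h4, if_true, if_false]
        have h6 := h4.rank_lt hc'
        refine ⟨Nat.add_le_add_left (Nat.log_mono_right (by omega)) _, fun h7 => ⟨by simp, ?_⟩⟩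
        intro _
        have := lt_two_mul_of_log_eq (a := T.rank c - T.rank e) (b := T.rank c' - T.rank e)
          (by omega) (by omega)
        omega
      · simp only [h1, h3, h4, if_true, if_false]
        exact ⟨Nat.zero_le _, fun h7 => by omega⟩
    · have h5 : ¬ T.Below c' e := fun h5 => h3 (h.trans h5)
      by_cases h4 : T.Below e c'
      · simp [h1, h3, h4]
      · simp [h1, h3, h4, h5]

lemma downPotential_mono {U : Type*} {T : ParentTree U} {e c c' : U} (h : T.Below c' c) (hne : c' ≠ c) (hc' : c' ≠ e) :
    T.downPotential e c' ≤ T.downPotential e c ∧ (T.downPotential e c' = T.downPotential e c →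
      (T.Below e c → T.Below e c' ∧ 2 * T.rank c' ≤ T.rank c + T.rank e)) := by
  unfold downPotential
  have hlt := h.rank_lt hne
  by_cases h1 : T.Below e c'
  · have h2 := h1.trans h
    have h6 := h1.rank_lt hc'.symm
    simp only [h1, h2, if_true]
    refine ⟨Nat.add_le_add_left (Nat.log_mono_right (by omega)) _, fun h7 _ => ⟨trivial, ?_⟩⟩
    have := lt_two_mul_of_log_eq (a := T.rank e - T.rank c) (b := T.rank e - T.rank c')
      (by omega) (by omega)
    omega
  · by_cases h2 : T.Below e c
    · simp only [h1, h2, if_true, if_false]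
      exact ⟨Nat.zero_le _, fun h7 => by omega⟩
    · simp [h1, h2]

/-- A set on which an additive potential is bounded and whose level sets are antichains
is small. -/
lemma card_le_of_levels {U : Type*} {A p : Finset U} (φ : U → U → ℕ) {K : ℕ} (hp : p.card = 2)
    (hK : ∀ e c, φ e c ≤ K)
    (hlev : ∀ A' ⊆ A, (∀ c ∈ A', ∀ c' ∈ A', ∑ e ∈ p, φ e c = ∑ e ∈ p, φ e c') → A'.card ≤ 7) :
    A.card ≤ 7 * (2 * K + 1) := by
  calc A.card ≤ 7 * (A.image fun c => ∑ e ∈ p, φ e c).card := by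
        apply Finset.card_le_mul_card_image
        intro a _
        apply hlev _ (Finset.filter_subset _ _)
        intro c hc c' hc'
        rw [(Finset.mem_filter.1 hc).2, (Finset.mem_filter.1 hc').2]
    _ ≤ 7 * (Finset.range (2 * K + 1)).card := by
        apply Nat.mul_le_mul_left
        apply Finset.card_le_card
        intro a ha
        obtain ⟨c, -, rfl⟩ := Finset.mem_image.1 ha
        rw [Finset.mem_range, Nat.lt_succ_iff, ← hp, ← smul_eq_mul]
        exact Finset.sum_le_card_nsmul _ _ _ fun e _ => hK e c
    _ = _ := by rw [Finset.card_range]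

variable (T) in
/-- The points of a line which cannot be moved in both directions. -/
def badPoints (F : Finset (Finset W)) (p : Finset W) : Finset W :=
  (T.line F p).filter fun c => ¬ T.UpGood F p c ∨ ¬ T.DownGood F p c

lemma card_badPoints_le
    (hL : ∀ S : Finset W, S.Nonempty → S ≠ Finset.univ → L ≤ cutWeight w S)
    (hr : ∀ S ∈ F, T.root ∉ S) (hlt : ∀ S ∈ F, 2 * cutWeight w S < 3 * L)
    {N : ℕ} (hN : ∀ v, T.rank v ≤ N) {p : Finset W} (hp : p.card = 2) :
    (T.badPoints F p).card ≤ 14 * (2 * (2 + Nat.log 2 N) + 1) := by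
  have hpne : p.Nonempty := by rw [← Finset.card_pos]; omega
  have hup : ((T.line F p).filter fun c => ¬ T.UpGood F p c).card
      ≤ 7 * (2 * (2 + Nat.log 2 N) + 1) := by
    apply card_le_of_levels T.upPotential hp
    · intro e c
      unfold upPotential
      have := Nat.log_mono_right (b := 2) (show T.rank c - T.rank e ≤ N by have := hN c; omega)
      split_ifs <;> omega
    · intro A' hA' hlev
      apply card_antichain_le hL hr hlt hpne (hA'.trans (Finset.filter_subset _ _))
      intro c hc c' hc' hb
      by_contra hne
      have h1 := Finset.mem_filter.1 (hA' hc)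
      have h2 := Finset.mem_filter.1 (hA' hc')
      apply h1.2
      have hpc : ∀ e ∈ p, c ≠ e := fun e he h => (mem_line.1 h1.1).1 (h ▸ he)
      have hpc' : ∀ e ∈ p, c' ≠ e := fun e he h => (mem_line.1 h2.1).1 (h ▸ he)
      have h3 := (Finset.sum_eq_sum_iff_of_le fun e he =>
        (upPotential_mono hb hne (hpc e he) (hpc' e he)).1).1 (hlev c' hc' c hc)
      exact ⟨c', h2.1, Ne.symm hne, hb, fun e he =>
        (upPotential_mono hb hne (hpc e he) (hpc' e he)).2 (h3 e he)⟩
  have hdn : ((T.line F p).filter fun c => ¬ T.DownGood F p c).card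
      ≤ 7 * (2 * (2 + Nat.log 2 N) + 1) := by
    apply card_le_of_levels T.downPotential hp
    · intro e c
      unfold downPotential
      have := Nat.log_mono_right (b := 2) (show T.rank e - T.rank c ≤ N by have := hN e; omega)
      split_ifs <;> omega
    · intro A' hA' hlev
      apply card_antichain_le hL hr hlt hpne (hA'.trans (Finset.filter_subset _ _))
      intro c' hc' c hc hb
      by_contra hne
      have h1 := Finset.mem_filter.1 (hA' hc)
      have h2 := Finset.mem_filter.1 (hA' hc')
      apply h1.2
      have hpc' : ∀ e ∈ p, c' ≠ e := fun e he h => (mem_line.1 h2.1).1 (h ▸ he)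
      have h3 := (Finset.sum_eq_sum_iff_of_le fun e he =>
        (downPotential_mono hb hne (hpc' e he)).1).1 (hlev c' hc' c hc)
      exact ⟨c', h2.1, hne, hb, fun e he =>
        (downPotential_mono hb hne (hpc' e he)).2 (h3 e he)⟩
  unfold badPoints
  rw [Finset.filter_or]
  have := Finset.card_union_le ((T.line F p).filter fun c => ¬ T.UpGood F p c)
    ((T.line F p).filter fun c => ¬ T.DownGood F p c)
  omega

lemma exists_mem_badPoints
    (hL : ∀ S : Finset W, S.Nonempty → S ≠ Finset.univ → L ≤ cutWeight w S)
    (hr : ∀ S ∈ F, T.root ∉ S)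
    (hcomp : ∀ S ∈ F, ∀ S' ∈ F, 4 * cutWeight w S' < 3 * L + 2 * cutWeight w S)
    (hlt : ∀ S ∈ F, 2 * cutWeight w S < 3 * L)
    {S : Finset W} (hS : S ∈ F) (hcard : (T.crossing S).card = 3) :
    ∃ c ∈ T.crossing S, c ∈ T.badPoints F ((T.crossing S).erase c) := by
  by_contra hcon
  push Not at hcon
  set x := T.crossing S with hx
  have hgood : ∀ c ∈ x, T.UpGood F (x.erase c) c ∧ T.DownGood F (x.erase c) c := by
    intro c hc
    have h1 := hcon c hc
    have h2 : c ∈ T.line F (x.erase c) :=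
      mem_line.2 ⟨Finset.notMem_erase _ _, S, hS, by rw [Finset.insert_erase hc]⟩
    rw [badPoints, Finset.mem_filter] at h1
    tauto
  have hup : ∀ c, ∃ c', c ∈ x → c' ∈ T.line F (x.erase c) ∧ c' ≠ c ∧ T.Below c c' ∧
      ∀ e ∈ x.erase c, (T.Below e c' → T.Below e c) ∧
        (T.Below c e → T.rank c + T.rank e ≤ 2 * T.rank c') := by
    intro c
    by_cases hc : c ∈ x
    · obtain ⟨c', h⟩ := (hgood c hc).1
      exact ⟨c', fun _ => h⟩
    · exact ⟨c, fun h => absurd h hc⟩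
  have hdn : ∀ c, ∃ c', c ∈ x → c' ∈ T.line F (x.erase c) ∧ c' ≠ c ∧ T.Below c' c ∧
      ∀ e ∈ x.erase c, T.Below e c → T.Below e c' ∧ 2 * T.rank c' ≤ T.rank c + T.rank e := by
    intro c
    by_cases hc : c ∈ x
    · obtain ⟨c', h⟩ := (hgood c hc).2
      exact ⟨c', fun _ => h⟩
    · exact ⟨c, fun h => absurd h hc⟩
  choose up hup using hup
  choose dn hdn using hdn
  have hxr : ∀ c ∈ x, c ≠ T.root := fun c hc => (mem_crossing.1 hc).1
  have hnest : ∀ a ∈ x, ∀ c ∈ x, a ≠ c → T.Below a c → ∀ u, T.Below u (up a) →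
      T.Below u (dn c) := by
    intro a ha c hc hac hb u hu
    have h1 := ((hup a ha).2.2.2 c (Finset.mem_erase.2 ⟨hac.symm, hc⟩)).2 hb
    have h2 := (hdn c hc).2.2.2 a (Finset.mem_erase.2 ⟨hac, ha⟩) hb
    rcases (hup a ha).2.2.1.total h2.1 with h | h
    · exact hu.trans h
    · by_cases heq : dn c = up a
      · rw [heq]; exact hu
      · have := h.rank_lt heq
        omega
  have hinc : ∀ a ∈ x, ∀ c ∈ x, a ≠ c → T.Below (up a) (up c) → T.Below a c := by
    intro a ha c hc hac h
    exact ((hup c hc).2.2.2 a (Finset.mem_erase.2 ⟨hac, ha⟩)).1 ((hup a ha).2.2.1.trans h)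
  have hdisj : ∀ a ∈ x, ∀ c ∈ x, ∀ u, T.Below u (up a) → ¬ T.Below u (dn a) →
      T.Below u (up c) → ¬ T.Below u (dn c) → a = c := by
    intro a ha c hc u h1 h2 h3 h4
    by_contra hac
    rcases h1.total h3 with h | h
    · exact h4 (hnest a ha c hc hac (hinc a ha c hc hac h) u h1)
    · exact h2 (hnest c hc a ha (Ne.symm hac) (hinc c hc a ha (Ne.symm hac) h) u h3)
  let q : W × Bool → W := fun i => if i.2 then up i.1 else dn i.1
  let P : W × Bool → Finset W := fun i => symmDiff (T.subtree i.1) (T.subtree (q i))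
  have hq : ∀ i : W × Bool, i.1 ∈ x → q i ∈ T.line F (x.erase i.1) ∧ q i ≠ i.1 := by
    rintro ⟨c, b⟩ hc
    cases b
    · exact ⟨(hdn c hc).1, (hdn c hc).2.1⟩
    · exact ⟨(hup c hc).1, (hup c hc).2.1⟩
  have hPt : ∀ c ∈ x, ∀ u, u ∈ P (c, true) ↔ T.Below u (up c) ∧ ¬ T.Below u c := by
    intro c hc u
    have : T.Below u c → T.Below u (up c) := fun h => h.trans (hup c hc).2.2.1
    simp only [P, q, Finset.mem_symmDiff, mem_subtree, if_true]
    tauto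
  have hPf : ∀ c ∈ x, ∀ u, u ∈ P (c, false) ↔ T.Below u c ∧ ¬ T.Below u (dn c) := by
    intro c hc u
    have : T.Below u (dn c) → T.Below u c := fun h => h.trans (hdn c hc).2.2.1
    simp only [P, q, Finset.mem_symmDiff, mem_subtree, Bool.false_eq_true, if_false]
    tauto
  have hPR : ∀ i : W × Bool, i.1 ∈ x → ∀ u, u ∈ P i →
      T.Below u (up i.1) ∧ ¬ T.Below u (dn i.1) := by
    rintro ⟨c, b⟩ hc u hu
    cases b
    · have := (hPf c hc u).1 hu
      exact ⟨this.1.trans (hup c hc).2.2.1, this.2⟩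
    · have := (hPt c hc u).1 hu
      exact ⟨this.1, fun h => this.2 (h.trans (hdn c hc).2.2.1)⟩
  have hPdisj : ∀ i ∈ x ×ˢ (Finset.univ : Finset Bool), ∀ j ∈ x ×ˢ (Finset.univ : Finset Bool),
      ∀ u, u ∈ P i → u ∈ P j → i = j := by
    rintro ⟨a, i⟩ ha ⟨c, j⟩ hc u hu hu'
    have ha := (Finset.mem_product.1 ha).1
    have hc := (Finset.mem_product.1 hc).1
    have h1 := hPR _ ha u hu
    have h2 := hPR _ hc u hu'
    have hac := hdisj a ha c hc u h1.1 h1.2 h2.1 h2.2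
    subst hac
    have h3 := hPt a ha u
    have h4 := hPf a ha u
    cases i <;> cases j <;> first | rfl | (exfalso; tauto)
  have hPL : ∀ i ∈ x ×ˢ (Finset.univ : Finset Bool), L ≤ cutWeight w (P i) := by
    intro i hi
    have hi := (Finset.mem_product.1 hi).1
    apply hL
    · obtain ⟨c, b⟩ := i
      cases b
      · exact ⟨c, (hPf c hi c).2 ⟨Below.refl T c,
          fun h => (hdn c hi).2.1 ((hdn c hi).2.2.1.antisymm h)⟩⟩
      · exact ⟨up c, (hPt c hi _).2 ⟨Below.refl T _,
          fun h => (hup c hi).2.1 (h.antisymm (hup c hi).2.2.1)⟩⟩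
    · intro h
      have h1 := (hPR i hi T.root (h ▸ Finset.mem_univ _)).1
      rw [below_root] at h1
      exact ne_root_of_mem_line (hup i.1 hi).1 h1
  have hPF : ∀ i ∈ x ×ˢ (Finset.univ : Finset Bool), symmDiff S (P i) ∈ F := by
    intro i hi
    have hi := (Finset.mem_product.1 hi).1
    obtain ⟨h1, h2⟩ := hq i hi
    have h3 := ne_root_of_mem_line h1
    obtain ⟨h4, S', hS', hTS'⟩ := mem_line.1 h1
    have : symmDiff S (P i) = S' := by
      apply T.crossing_injective _ (hr _ hS')
      · simp only [P]
        rw [crossing_symmDiff, crossing_symmDiff, crossing_subtree h3,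
          crossing_subtree (hxr _ hi), hTS', ← hx]
        ext v
        simp only [Finset.mem_symmDiff, Finset.mem_insert, Finset.mem_singleton, Finset.mem_erase]
        rw [Finset.mem_erase] at h4
        by_cases hv : v = q i
        · subst hv; tauto
        · by_cases hv' : v = i.1
          · subst hv'; tauto
          · tauto
      · simp only [P, Finset.mem_symmDiff]
        have := T.root_notMem_subtree (hxr _ hi)
        have := T.root_notMem_subtree h3
        have := hr _ hS
        tauto
    exact this ▸ hS'
  have key := card_mul_cutWeight_add_sum_le w S (x ×ˢ (Finset.univ : Finset Bool)) P hPdisj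
  have hc6 : (x ×ˢ (Finset.univ : Finset Bool)).card = 6 := by
    rw [Finset.card_product, hcard]; rfl
  have h1 := Finset.card_nsmul_le_sum _ _ _ hPL
  have h2 : ∑ i ∈ x ×ˢ (Finset.univ : Finset Bool), 4 * cutWeight w (symmDiff S (P i)) <
      ∑ i ∈ x ×ˢ (Finset.univ : Finset Bool), (3 * L + 2 * cutWeight w S) :=
    Finset.sum_lt_sum_of_nonempty (by rw [← Finset.card_pos]; omega)
      fun i hi => hcomp S hS _ (hPF i hi)
  have h3 := hlt S hS
  rw [← Finset.mul_sum, Finset.sum_const, smul_eq_mul] at h2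
  rw [smul_eq_mul] at h1
  rw [hc6] at h1 h2 key
  omega

lemma card_filter_crossing_eq_three_le
    (hL : ∀ S : Finset W, S.Nonempty → S ≠ Finset.univ → L ≤ cutWeight w S)
    (hr : ∀ S ∈ F, T.root ∉ S)
    (hcomp : ∀ S ∈ F, ∀ S' ∈ F, 4 * cutWeight w S' < 3 * L + 2 * cutWeight w S)
    (hlt : ∀ S ∈ F, 2 * cutWeight w S < 3 * L)
    {N : ℕ} (hN : ∀ v, T.rank v ≤ N) :
    (F.filter fun S => (T.crossing S).card = 3).card ≤
      Fintype.card W ^ 2 * (14 * (2 * (2 + Nat.log 2 N) + 1)) := by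
  rw [← Finset.card_image_of_injOn (f := T.crossing)]
  · calc _ ≤ ((Finset.univ.powersetCard 2).biUnion fun p : Finset W =>
            (T.badPoints F p).image fun c => insert c p).card := by
          apply Finset.card_le_card
          intro x hx
          obtain ⟨S, hS, rfl⟩ := Finset.mem_image.1 hx
          rw [Finset.mem_filter] at hS
          obtain ⟨c, hc, hcb⟩ := exists_mem_badPoints hL hr hcomp hlt hS.1 hS.2
          rw [Finset.mem_biUnion]
          refine ⟨(T.crossing S).erase c, ?_, ?_⟩
          · rw [Finset.mem_powersetCard, Finset.card_erase_of_mem hc, hS.2]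
            exact ⟨Finset.subset_univ _, rfl⟩
          · exact Finset.mem_image.2 ⟨c, hcb, Finset.insert_erase hc⟩
      _ ≤ (Finset.univ.powersetCard 2 : Finset (Finset W)).card *
            (14 * (2 * (2 + Nat.log 2 N) + 1)) := by
          apply Finset.card_biUnion_le_card_mul
          intro p hp
          exact Finset.card_image_le.trans
            (card_badPoints_le hL hr hlt hN (Finset.mem_powersetCard.1 hp).2)
      _ ≤ _ := by
          apply Nat.mul_le_mul_right
          rw [Finset.card_powersetCard, Finset.card_univ]
          exact Nat.choose_le_pow _ _
  · intro S hS S' hS' h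
    simp only [Finset.coe_filter, Set.mem_ofPred_eq] at hS hS'
    exact T.crossing_injective (hr _ hS.1) (hr _ hS'.1) h

lemma card_filter_crossing_le_two_le (hr : ∀ S ∈ F, T.root ∉ S) (hne : ∀ S ∈ F, S.Nonempty) :
    (F.filter fun S => (T.crossing S).card ≤ 2).card ≤ Fintype.card W ^ 2 := by
  rw [← Finset.card_image_of_injOn (f := T.crossing)]
  · calc _ ≤ ((Finset.univ : Finset (W × W)).image fun i => ({i.1, i.2} : Finset W)).card := by
          apply Finset.card_le_card
          intro x hx
          obtain ⟨S, hS, rfl⟩ := Finset.mem_image.1 hx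
          rw [Finset.mem_filter] at hS
          have h1 := T.crossing_nonempty (hr _ hS.1) (hne _ hS.1)
          rw [← Finset.card_pos] at h1
          rw [Finset.mem_image]
          obtain h2 | h2 : (T.crossing S).card = 1 ∨ (T.crossing S).card = 2 := by omega
          · obtain ⟨a, ha⟩ := Finset.card_eq_one.1 h2
            exact ⟨(a, a), Finset.mem_univ _, by simp [ha]⟩
          · obtain ⟨a, b, -, hab⟩ := Finset.card_eq_two.1 h2
            exact ⟨(a, b), Finset.mem_univ _, hab.symm⟩
      _ ≤ _ := by
          refine Finset.card_image_le.trans ?_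
          rw [Finset.card_univ, Fintype.card_prod, sq]
  · intro S hS S' hS' h
    simp only [Finset.coe_filter, Set.mem_ofPred_eq] at hS hS'
    exact T.crossing_injective (hr _ hS.1) (hr _ hS'.1) h

end lines

end ParentTree

/-- One run of Prim's algorithm, stopped after `k` vertices. -/
lemma exists_prim_stage {W : Type*} [Fintype W] (c : W → W → ℕ) (r : W) (k : ℕ) :
    k + 1 ≤ Fintype.card W → ∃ (A : Finset W) (π : W → W) (ρ : W → ℕ),
      A.card = k + 1 ∧ r ∈ A ∧ π r = r ∧ ρ r = 0 ∧ (∀ v ∈ A, ρ v < k + 1) ∧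
      Set.InjOn ρ A ∧ (∀ v ∈ A, v ≠ r → π v ∈ A ∧ ρ (π v) < ρ v) ∧
      ∀ v ∈ A, v ≠ r → ∀ x ∈ A, ∀ y, ρ x < ρ v → (y ∈ A → ρ v ≤ ρ y) → c (π v) v ≤ c x y := by
  induction k with
  | zero =>
    intro _
    refine ⟨{r}, id, fun _ => 0, by simp, by simp, rfl, rfl, by simp, by simp, ?_, ?_⟩ <;>
      simp +contextual
  | succ k ih =>
    intro hk
    obtain ⟨A, π, ρ, hA, hrA, hπ, hρ, hlt, hinj, hpar, hmin⟩ := ih (by omega)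
    have hAc : Aᶜ.Nonempty := by
      rw [← Finset.card_pos, Finset.card_compl]; omega
    obtain ⟨⟨x, y⟩, hxy, hxymin⟩ := Finset.exists_min_image (A ×ˢ Aᶜ) (fun e => c e.1 e.2)
      (Finset.Nonempty.product ⟨r, hrA⟩ hAc)
    rw [Finset.mem_product, Finset.mem_compl] at hxy
    obtain ⟨hx, hy⟩ := hxy
    simp only at hx hy
    have hry : r ≠ y := fun h => hy (h ▸ hrA)
    have hne : ∀ v ∈ A, v ≠ y := fun v hv h => hy (h ▸ hv)
    refine ⟨insert y A, Function.update π y x, Function.update ρ y (k + 1), ?_, ?_, ?_, ?_,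
      ?_, ?_, ?_, ?_⟩
    · rw [Finset.card_insert_of_notMem hy, hA]
    · exact Finset.mem_insert_of_mem hrA
    · rw [Function.update_of_ne hry, hπ]
    · rw [Function.update_of_ne hry, hρ]
    · intro v hv
      rcases Finset.mem_insert.1 hv with rfl | hv
      · simp
      · rw [Function.update_of_ne (hne v hv)]
        have := hlt v hv
        omega
    · intro u hu v hv huv
      rw [Finset.mem_coe, Finset.mem_insert] at hu hv
      rcases hu with rfl | hu <;> rcases hv with rfl | hv
      · rfl
      · rw [Function.update_self, Function.update_of_ne (hne v hv)] at huv
        have := hlt v hv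
        omega
      · rw [Function.update_self, Function.update_of_ne (hne u hu)] at huv
        have := hlt u hu
        omega
      · rw [Function.update_of_ne (hne v hv), Function.update_of_ne (hne u hu)] at huv
        exact hinj hu hv huv
    · intro v hv hvr
      rcases Finset.mem_insert.1 hv with rfl | hv
      · rw [Function.update_self, Function.update_self, Function.update_of_ne (hne x hx)]
        exact ⟨Finset.mem_insert_of_mem hx, hlt x hx⟩
      · rw [Function.update_of_ne (hne v hv), Function.update_of_ne (hne v hv)]
        obtain ⟨h1, h2⟩ := hpar v hv hvr
        rw [Function.update_of_ne (hne _ h1)]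
        exact ⟨Finset.mem_insert_of_mem h1, h2⟩
    · intro v hv hvr x' hx' y' hlt' hle
      rcases Finset.mem_insert.1 hv with rfl | hv
      · rw [Function.update_self] at hlt' hle ⊢
        have hx'' : x' ∈ A := by
          rcases Finset.mem_insert.1 hx' with rfl | h
          · rw [Function.update_self] at hlt'; omega
          · exact h
        have hy'' : y' ∉ A := by
          intro h
          have h1 := hle (Finset.mem_insert_of_mem h)
          rw [Function.update_of_ne (hne _ h)] at h1
          have := hlt y' h
          omega
        exact hxymin (x', y') (Finset.mem_product.2 ⟨hx'', Finset.mem_compl.2 hy''⟩)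
      · rw [Function.update_of_ne (hne v hv)] at hlt' hle ⊢
        have hv1 := hlt v hv
        have hx'' : x' ∈ A := by
          rcases Finset.mem_insert.1 hx' with rfl | h
          · rw [Function.update_self] at hlt'; omega
          · exact h
        rw [Function.update_of_ne (hne _ hx'')] at hlt'
        refine hmin v hv hvr x' hx'' y' hlt' fun h => ?_
        have h1 := hle (Finset.mem_insert_of_mem h)
        rwa [Function.update_of_ne (hne _ h)] at h1

/-- Prim's algorithm. -/
lemma exists_prim_tree {W : Type*} [Fintype W] (c : W → W → ℕ) (r : W) :
    ∃ T : ParentTree W, T.root = r ∧ T.rank r = 0 ∧ Function.Injective T.rank ∧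
      (∀ v, T.rank v < Fintype.card W) ∧ ∀ v, v ≠ r → ∀ x y, T.rank x < T.rank v →
        T.rank v ≤ T.rank y → c (T.parent v) v ≤ c x y := by
  have hpos : 0 < Fintype.card W := Fintype.card_pos_iff.2 ⟨r⟩
  obtain ⟨A, π, ρ, hA, -, hπ, hρ, hlt, hinj, hpar, hmin⟩ :=
    exists_prim_stage c r (Fintype.card W - 1) (by omega)
  have hu : A = Finset.univ := by
    rw [← Finset.card_eq_iff_eq_univ]; omega
  subst hu
  refine ⟨⟨r, π, ρ, hπ, fun v hv => (hpar v (Finset.mem_univ _) hv).2⟩, rfl, hρ, ?_, ?_, ?_⟩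
  · intro u v h
    exact hinj (Finset.mem_coe.2 (Finset.mem_univ _)) (Finset.mem_coe.2 (Finset.mem_univ _)) h
  · intro v
    have := hlt v (Finset.mem_univ _)
    simp only
    omega
  · intro v hv x y hx hy
    exact hmin v (Finset.mem_univ _) hv x (Finset.mem_univ _) y hx fun _ => hy

/-- The classes of a map `s` all have large cut weight, so many pairs are separated by `s`. -/
lemma card_mul_le_separated {W : Type*} [Fintype W] (w : W → W → ℕ) {L : ℕ}
    (hL : ∀ S : Finset W, S.Nonempty → S ≠ Finset.univ → L ≤ cutWeight w S)
    (J : Finset W) (hJ : 2 ≤ J.card) (s : W → W) (hs : ∀ j ∈ J, s j = j) :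
    J.card * L ≤ 2 * ∑ u, ∑ v, w u v * if s u = s v then 0 else 1 := by
  have h1 : J.card * L ≤ ∑ j ∈ J, cutWeight w (Finset.univ.filter fun u => s u = j) := by
    rw [← smul_eq_mul]
    apply Finset.card_nsmul_le_sum
    intro j hj
    apply hL
    · exact ⟨j, by simp [hs j hj]⟩
    · intro h
      obtain ⟨i, hi, hij⟩ := Finset.exists_mem_ne (by omega : 1 < J.card) j
      have := Finset.mem_univ i
      rw [← h, Finset.mem_filter, hs i hi] at this
      exact hij this.2
  refine h1.trans ?_
  simp only [cutWeight, Finset.mul_sum]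
  rw [Finset.sum_comm]
  apply Finset.sum_le_sum
  intro u _
  rw [Finset.sum_comm]
  apply Finset.sum_le_sum
  intro v _
  rw [← Finset.mul_sum, mul_left_comm]
  apply Nat.mul_le_mul_left
  simp only [Finset.mem_filter, Finset.mem_univ, true_and]
  by_cases h : s u = s v
  · simp [h]
  · calc _ ≤ ∑ j ∈ J, ((if s u = j then 1 else 0) + (if s v = j then 1 else 0)) := by
          apply Finset.sum_le_sum
          intro i _
          split_ifs <;> first | omega | tauto
      _ ≤ _ := by
          rw [Finset.sum_add_distrib, Finset.sum_ite_eq, Finset.sum_ite_eq]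
          split_ifs <;> omega

lemma card_threshold_le {W : Type*} [Fintype W] (w : W → W → ℕ) {L : ℕ}
    (hL : ∀ S : Finset W, S.Nonempty → S ≠ Finset.univ → L ≤ cutWeight w S)
    (c : W → W → ℕ) (hc : ∀ u v, c u v = c v u) (T : ParentTree W) (h0 : T.rank T.root = 0)
    (hinj : Function.Injective T.rank)
    (hmin : ∀ v, v ≠ T.root → ∀ x y, T.rank x < T.rank v →
        T.rank v ≤ T.rank y → c (T.parent v) v ≤ c x y) (t : ℕ) :
    L * (Finset.univ.filter fun v => v ≠ T.root ∧ t < c (T.parent v) v).card ≤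
      2 * ∑ u, ∑ v, w u v * if t < c u v then 1 else 0 := by
  set I := Finset.univ.filter fun v => v ≠ T.root ∧ t < c (T.parent v) v with hI
  rcases I.eq_empty_or_nonempty with h | hne
  · simp [h]
  have hrI : T.root ∉ I := by simp [hI]
  have hex : ∀ u, ∃ j ∈ insert T.root I, T.rank j ≤ T.rank u ∧
      ∀ i ∈ insert T.root I, T.rank i ≤ T.rank u → T.rank i ≤ T.rank j := by
    intro u
    obtain ⟨j, hj, hjmax⟩ := Finset.exists_max_image
      ((insert T.root I).filter fun j => T.rank j ≤ T.rank u) T.rank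
      ⟨T.root, by simp [h0]⟩
    rw [Finset.mem_filter] at hj
    exact ⟨j, hj.1, hj.2, fun i hi hiu => hjmax i (Finset.mem_filter.2 ⟨hi, hiu⟩)⟩
  choose s hsJ hsle hsmax using hex
  have hcard : (insert T.root I).card = I.card + 1 := Finset.card_insert_of_notMem hrI
  have hIpos : 0 < I.card := Finset.card_pos.2 hne
  have h1 := card_mul_le_separated w hL (insert T.root I) (by omega) s fun j hj =>
    hinj (le_antisymm (hsle j) (hsmax j j hj le_rfl))
  have hsep : ∀ u v, T.rank (s u) < T.rank (s v) → t < c u v := by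
    intro u v h
    have hv : s v ∈ I := by
      rcases Finset.mem_insert.1 (hsJ v) with h' | h'
      · rw [h', h0] at h; omega
      · exact h'
    rw [hI, Finset.mem_filter] at hv
    refine hv.2.2.trans_le (hmin _ hv.2.1 u v ?_ (hsle v))
    by_contra hcon
    have := hsmax u (s v) (hsJ v) (by omega)
    omega
  calc L * I.card ≤ (insert T.root I).card * L := by
        rw [hcard, mul_comm]; exact Nat.mul_le_mul_right _ (by omega)
    _ ≤ _ := h1
    _ ≤ _ := by
        apply Nat.mul_le_mul_left
        refine Finset.sum_le_sum fun u _ => Finset.sum_le_sum fun v _ =>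
          Nat.mul_le_mul_left _ ?_
        by_cases h : s u = s v
        · simp [h]
        · have h2 : t < c u v := by
            rcases lt_trichotomy (T.rank (s u)) (T.rank (s v)) with h3 | h3 | h3
            · exact hsep u v h3
            · exact absurd (hinj h3) h
            · rw [hc]; exact hsep v u h3
          simp only [h2, if_true]
          split_ifs
          omega

lemma sum_range_ite_lt {M a : ℕ} (h : a ≤ M) :
    ∑ t ∈ Finset.range M, (if t < a then 1 else 0) = a := by
  rw [Finset.sum_boole, Nat.cast_id]
  have : (Finset.range M).filter (fun t => t < a) = Finset.range a := by
    ext t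
    simp only [Finset.mem_filter, Finset.mem_range]
    omega
  rw [this, Finset.card_range]

/-- There is a spanning tree which, on average over `F`, is crossed few times. -/
lemma exists_tree_sum_crossing_le {W : Type*} [Fintype W] (w : W → W → ℕ) {L : ℕ}
    (hL : ∀ S : Finset W, S.Nonempty → S ≠ Finset.univ → L ≤ cutWeight w S) (r : W)
    (F : Finset (Finset W)) :
    ∃ T : ParentTree W, T.root = r ∧ (∀ v, T.rank v < Fintype.card W) ∧
      L * ∑ S ∈ F, (T.crossing S).card ≤ 2 * ∑ S ∈ F, cutWeight w S := by
  let c : W → W → ℕ := fun u v => ∑ S ∈ F, if (u ∈ S ↔ v ∈ S) then 0 else 1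
  have hc : ∀ u v, c u v = c v u := fun u v =>
    Finset.sum_congr rfl fun S _ => if_congr Iff.comm rfl rfl
  have hcF : ∀ u v, c u v ≤ F.card := by
    intro u v
    rw [Finset.card_eq_sum_ones]
    apply Finset.sum_le_sum
    intro S _
    split_ifs <;> omega
  obtain ⟨T, rfl, h0, hinj, hN, hmin⟩ := exists_prim_tree c r
  refine ⟨T, rfl, hN, ?_⟩
  have h1 : ∑ S ∈ F, cutWeight w S = ∑ u, ∑ v, w u v * c u v := by
    simp only [cutWeight, c, Finset.mul_sum]
    rw [Finset.sum_comm]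
    apply Finset.sum_congr rfl
    intro u _
    rw [Finset.sum_comm]
  have h2 : ∑ S ∈ F, (T.crossing S).card =
      ∑ v ∈ Finset.univ.filter fun v => v ≠ T.root, c (T.parent v) v := by
    simp only [c]
    rw [Finset.sum_comm]
    apply Finset.sum_congr rfl
    intro S _
    rw [ParentTree.crossing, ← Finset.filter_filter, Finset.card_filter]
    exact Finset.sum_congr rfl fun v _ => by split_ifs <;> tauto
  have h3 : ∑ v ∈ Finset.univ.filter fun v => v ≠ T.root, c (T.parent v) v =
      ∑ t ∈ Finset.range F.card,
        (Finset.univ.filter fun v => v ≠ T.root ∧ t < c (T.parent v) v).card := by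
    simp only [← Finset.filter_filter, Finset.card_filter]
    refine Eq.trans ?_ Finset.sum_comm
    exact Finset.sum_congr rfl fun v _ => (sum_range_ite_lt (hcF _ _)).symm
  have h4 : ∑ u, ∑ v, w u v * c u v =
      ∑ t ∈ Finset.range F.card, ∑ u, ∑ v, w u v * if t < c u v then 1 else 0 := by
    refine Eq.trans ?_ Finset.sum_comm
    apply Finset.sum_congr rfl
    intro u _
    refine Eq.trans ?_ Finset.sum_comm
    apply Finset.sum_congr rfl
    intro v _
    rw [← Finset.mul_sum, sum_range_ite_lt (hcF _ _)]
  rw [h1, h2, h3, h4, Finset.mul_sum, Finset.mul_sum]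
  exact Finset.sum_le_sum fun t _ => card_threshold_le w hL c hc T h0 hinj hmin t

/-- The number of cuts in a family of near-minimum cuts of comparable deficiency. -/
lemma card_comparable_le {W : Type*} [Fintype W] (w : W → W → ℕ) {L : ℕ}
    (hL : ∀ S : Finset W, S.Nonempty → S ≠ Finset.univ → L ≤ cutWeight w S) (r : W)
    (F : Finset (Finset W)) (hr : ∀ S ∈ F, r ∉ S) (hne : ∀ S ∈ F, S.Nonempty)
    (hlt : ∀ S ∈ F, 2 * cutWeight w S < 3 * L)
    (hcomp : ∀ S ∈ F, ∀ S' ∈ F, 4 * cutWeight w S' < 3 * L + 2 * cutWeight w S) :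
    F.card ≤ 3 * (Fintype.card W ^ 2 * (28 * (Nat.log 2 (Fintype.card W) + 3))) := by
  rcases F.eq_empty_or_nonempty with rfl | hF
  · simp
  obtain ⟨T, rfl, hN, hT⟩ := exists_tree_sum_crossing_le w hL r F
  have h1 := ParentTree.card_filter_crossing_eq_three_le hL hr hcomp hlt fun v => (hN v).le
  have h2 := ParentTree.card_filter_crossing_le_two_le hr hne
  have h3 : ∑ S ∈ F, 2 * cutWeight w S < ∑ S ∈ F, 3 * L :=
    Finset.sum_lt_sum_of_nonempty hF hlt
  rw [← Finset.mul_sum, Finset.sum_const, smul_eq_mul] at h3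
  have h4 : ∑ S ∈ F, (T.crossing S).card < 3 * F.card := by
    have : L * ∑ S ∈ F, (T.crossing S).card < L * (3 * F.card) :=
      hT.trans_lt (h3.trans_eq (by ring))
    exact lt_of_mul_lt_mul_left this (Nat.zero_le _)
  have h5 : 4 * F.card ≤ ∑ S ∈ F, (T.crossing S).card +
      3 * ((F.filter fun S => (T.crossing S).card ≤ 2).card +
        (F.filter fun S => (T.crossing S).card = 3).card) := by
    rw [Finset.card_filter, Finset.card_filter, ← Finset.sum_add_distrib, Finset.mul_sum,
      ← Finset.sum_add_distrib, mul_comm, ← smul_eq_mul]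
    apply Finset.card_nsmul_le_sum
    intro S hS
    have := Finset.card_pos.2 (T.crossing_nonempty (hr S hS) (hne S hS))
    split_ifs <;> omega
  nlinarith [h1, h2, h4, h5, Nat.zero_le (Fintype.card W ^ 2)]

/-- The number of cuts of weight less than `3 / 2` times the minimum. -/
lemma card_cuts_le {W : Type*} [Fintype W] (w : W → W → ℕ) {L : ℕ}
    (hL : ∀ S : Finset W, S.Nonempty → S ≠ Finset.univ → L ≤ cutWeight w S) (r : W) :
    (Finset.univ.filter fun S : Finset W =>
        r ∉ S ∧ S.Nonempty ∧ 2 * cutWeight w S < 3 * L).card ≤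
      3 * (Fintype.card W ^ 2 * (28 * (Nat.log 2 (Fintype.card W) + 3))) *
        (Nat.log 2 (3 * L) + 1) := by
  set F := Finset.univ.filter fun S : Finset W =>
        r ∉ S ∧ S.Nonempty ∧ 2 * cutWeight w S < 3 * L with hF
  have hmem : ∀ S ∈ F, r ∉ S ∧ S.Nonempty ∧ 2 * cutWeight w S < 3 * L :=
    fun S hS => (Finset.mem_filter.1 hS).2
  let f : Finset W → ℕ := fun S => Nat.log 2 (3 * L - 2 * cutWeight w S)
  calc F.card ≤ 3 * (Fintype.card W ^ 2 * (28 * (Nat.log 2 (Fintype.card W) + 3))) *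
        (F.image f).card := by
        apply Finset.card_le_mul_card_image
        intro a _
        have hm : ∀ S ∈ F.filter fun S => f S = a, S ∈ F ∧ f S = a :=
          fun S hS => Finset.mem_filter.1 hS
        apply card_comparable_le w hL r
        · exact fun S hS => (hmem S (hm S hS).1).1
        · exact fun S hS => (hmem S (hm S hS).1).2.1
        · exact fun S hS => (hmem S (hm S hS).1).2.2
        · intro S hS S' hS'
          have h1 := (hmem S (hm S hS).1).2.2
          have h2 := (hmem S' (hm S' hS').1).2.2
          have h3 := ParentTree.lt_two_mul_of_log_eq (a := 3 * L - 2 * cutWeight w S)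
            (b := 3 * L - 2 * cutWeight w S') (by omega)
            ((hm S hS).2.trans (hm S' hS').2.symm)
          omega
    _ ≤ 3 * (Fintype.card W ^ 2 * (28 * (Nat.log 2 (Fintype.card W) + 3))) *
        (Finset.range (Nat.log 2 (3 * L) + 1)).card := by
        apply Nat.mul_le_mul_left
        apply Finset.card_le_card
        intro a ha
        obtain ⟨S, -, rfl⟩ := Finset.mem_image.1 ha
        rw [Finset.mem_range, Nat.lt_succ_iff]
        exact Nat.log_mono_right (by omega)
    _ = _ := by rw [Finset.card_range]

/-- The adjacency weights of `G`. -/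
def adjWeight {U : Type*} (G : SimpleGraph U) (u v : U) : ℕ := if G.Adj u v then 1 else 0

/-- The number of neighbours of `v` on the other side of the cut `S`. -/
def cutDegree (G : SimpleGraph V) (S : Finset V) (v : V) : ℕ :=
  ((G.neighborFinset v).filter fun u => ¬ (u ∈ S ↔ v ∈ S)).card

lemma cutDegree_le_degree (G : SimpleGraph V) (S : Finset V) (v : V) :
    cutDegree G S v ≤ G.degree v :=
  Finset.card_filter_le _ _

lemma cutDegree_eq_sum (G : SimpleGraph V) (S : Finset V) (v : V) :
    cutDegree G S v = ∑ u, adjWeight G v u * if (v ∈ S ↔ u ∈ S) then 0 else 1 := by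
  rw [cutDegree, Finset.card_filter, SimpleGraph.neighborFinset_eq_filter, Finset.sum_filter]
  apply Finset.sum_congr rfl
  intro u _
  unfold adjWeight
  split_ifs <;> first | rfl | tauto

lemma degree_eq_sum (G : SimpleGraph V) (v : V) : G.degree v = ∑ u, adjWeight G v u := by
  rw [← SimpleGraph.card_neighborFinset_eq_degree, SimpleGraph.neighborFinset_eq_filter,
    Finset.card_filter]
  rfl

lemma cutWeight_adjWeight (G : SimpleGraph V) (S : Finset V) :
    cutWeight (adjWeight G) S = ∑ v, cutDegree G S v := by
  simp only [cutDegree_eq_sum, cutWeight]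

lemma adjWeight_comm {U : Type*} (G : SimpleGraph U) (u v : U) : adjWeight G u v = adjWeight G v u :=
  if_congr (G.adj_comm u v) rfl rfl

lemma card_bdry (G : SimpleGraph V) (S : Finset V) :
    (bdry G S).card = ∑ v ∈ S, cutDegree G S v := by
  unfold cutDegree
  rw [← Finset.card_sigma]
  symm
  apply Finset.card_bij (fun e _ => s(e.1, e.2))
  · rintro ⟨u, v⟩ h
    simp only [Finset.mem_sigma, Finset.mem_filter, SimpleGraph.mem_neighborFinset] at h
    simp only [bdry, Finset.mem_filter, SimpleGraph.mem_edgeFinset, SimpleGraph.mem_edgeSet]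
    exact ⟨h.2.1, u, v, h.1, by tauto, rfl⟩
  · rintro ⟨u, v⟩ h ⟨u', v'⟩ h' heq
    simp only [Finset.mem_sigma, Finset.mem_filter] at h h'
    simp only [Sym2.eq_iff] at heq
    rcases heq with ⟨rfl, rfl⟩ | ⟨rfl, rfl⟩
    · rfl
    · exfalso; tauto
  · intro e he
    simp only [bdry, Finset.mem_filter] at he
    obtain ⟨he, u, v, hu, hv, rfl⟩ := he
    rw [SimpleGraph.mem_edgeFinset, SimpleGraph.mem_edgeSet] at he
    refine ⟨⟨u, v⟩, ?_, rfl⟩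
    simp only [Finset.mem_sigma, Finset.mem_filter, SimpleGraph.mem_neighborFinset]
    exact ⟨hu, he, by tauto⟩

lemma bdry_compl (G : SimpleGraph V) (S : Finset V) : bdry G Sᶜ = bdry G S := by
  unfold bdry
  apply Finset.filter_congr
  intro e _
  constructor
  · rintro ⟨u, v, hu, hv, rfl⟩
    exact ⟨v, u, by simpa using hv, by simpa using hu, Sym2.eq_swap⟩
  · rintro ⟨u, v, hu, hv, rfl⟩
    exact ⟨v, u, by simpa using hv, by simpa using hu, Sym2.eq_swap⟩

lemma cutDegree_compl (G : SimpleGraph V) (S : Finset V) (v : V) :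
    cutDegree G Sᶜ v = cutDegree G S v := by
  unfold cutDegree
  congr 1
  apply Finset.filter_congr
  intro u _
  simp only [Finset.mem_compl]
  tauto

lemma sum_cutDegree (G : SimpleGraph V) (S : Finset V) :
    ∑ v, cutDegree G S v = 2 * (bdry G S).card := by
  rw [← Finset.sum_add_sum_compl S, ← card_bdry, two_mul, add_right_inj, ← bdry_compl, card_bdry]
  simp only [cutDegree_compl]

lemma cutWeight_adjWeight_eq (G : SimpleGraph V) (S : Finset V) :
    cutWeight (adjWeight G) S = 2 * (bdry G S).card := by
  rw [cutWeight_adjWeight, sum_cutDegree]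

lemma econn_le (G : SimpleGraph V) {S : Finset V} (h : S.Nonempty) (h' : S ≠ Finset.univ) :
    econn G ≤ (bdry G S).card :=
  Nat.sInf_le ⟨S, h, h', rfl⟩

lemma econn_le_degree (G : SimpleGraph V) {v : V} (h : 1 ≤ G.degree v) :
    econn G ≤ G.degree v := by
  have hne : ({v} : Finset V) ≠ Finset.univ := by
    obtain ⟨u, hu⟩ := (G.degree_pos_iff_exists_adj v).1 h
    intro h
    have : u ∈ ({v} : Finset V) := h ▸ Finset.mem_univ _
    exact hu.ne' (Finset.mem_singleton.1 this)
  refine (econn_le G (Finset.singleton_nonempty v) hne).trans ?_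
  rw [card_bdry, Finset.sum_singleton]
  exact cutDegree_le_degree _ _ _

/-- The effect on the cut weight of moving one vertex across the cut. -/
lemma cutWeight_symmDiff_singleton (G : SimpleGraph V) (S : Finset V) (v : V) :
    cutWeight (adjWeight G) (symmDiff S {v}) + 4 * cutDegree G S v =
      cutWeight (adjWeight G) S + 2 * G.degree v := by
  have hsum : ∀ g : V → V → ℕ, ∑ x, ∑ y, adjWeight G x y * (g x y * if x = v then 1 else 0) =
      ∑ y, adjWeight G v y * g v y := by
    intro g
    rw [Finset.sum_eq_single v]
    · simp
    · intro x _ hx; simp [hx]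
    · simp
  have hsum' : ∀ g : V → V → ℕ, (∀ x y, g x y = g y x) →
      ∑ x, ∑ y, adjWeight G x y * (g x y * if y = v then 1 else 0) =
      ∑ y, adjWeight G v y * g v y := by
    intro g hg
    rw [Finset.sum_comm, ← hsum]
    refine Finset.sum_congr rfl fun x _ => Finset.sum_congr rfl fun y _ => ?_
    rw [adjWeight_comm, hg]
  let s : V → V → ℕ := fun x y => if (x ∈ S ↔ y ∈ S) then 0 else 1
  have hs : ∀ x y, s x y = s y x := fun x y => if_congr Iff.comm rfl rfl
  have h1 : cutDegree G S v = ∑ y, adjWeight G v y * s v y := cutDegree_eq_sum G S v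
  have h2 : G.degree v = ∑ y, adjWeight G v y * 1 := by simp [degree_eq_sum]
  have h3 := hsum s
  have h4 := hsum' s hs
  have h5 := hsum fun _ _ => 1
  have h6 := hsum' (fun _ _ => 1) fun _ _ => rfl
  rw [← h1] at h3 h4
  simp only [← h2] at h5 h6
  have key : ∑ x, ∑ y, adjWeight G x y *
        ((if (x ∈ symmDiff S {v} ↔ y ∈ symmDiff S {v}) then 0 else 1) +
          2 * (s x y * if x = v then 1 else 0) + 2 * (s x y * if y = v then 1 else 0)) =
      ∑ x, ∑ y, adjWeight G x y * (s x y + (1 * if x = v then 1 else 0) +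
        (1 * if y = v then 1 else 0)) := by
    refine Finset.sum_congr rfl fun x _ => Finset.sum_congr rfl fun y _ => ?_
    by_cases hxy : x = y
    · subst hxy
      simp [adjWeight]
    · congr 1
      simp only [s, Finset.mem_symmDiff, Finset.mem_singleton]
      by_cases hx : x = v
      · subst hx
        have : y ≠ x := Ne.symm hxy
        simp only [this, if_true, if_false]
        split_ifs <;> first | rfl | tauto
      · simp only [hx, if_false]
        by_cases hy : y = v
        · simp only [hy, if_true]
          split_ifs <;> first | rfl | tauto
        · simp only [hy, if_false]
          split_ifs <;> first | rfl | tauto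
  simp only [mul_add, Finset.sum_add_distrib, mul_left_comm _ 2, ← Finset.mul_sum, h3, h4, h5,
    h6] at key
  have h7 : cutWeight (adjWeight G) S = ∑ x, ∑ y, adjWeight G x y * s x y := rfl
  unfold cutWeight at h7 ⊢
  omega

section nearMinimum

variable {G : SimpleGraph V} {δ : ℕ} {S : Finset V}

lemma four_mul_cutDegree_le (hδ : 1 ≤ δ) (hd : ∀ v, δ ≤ G.degree v)
    (h1 : 2 ≤ S.card) (h2 : 2 ≤ Sᶜ.card) (h3 : 2 * (bdry G S).card < 3 * econn G) (v : V) :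
    4 * cutDegree G S v ≤ 3 * G.degree v := by
  have h4 := cutWeight_symmDiff_singleton G S v
  rw [cutWeight_adjWeight_eq, cutWeight_adjWeight_eq] at h4
  have h5 := econn_le_degree G (hδ.trans (hd v))
  have h6 : econn G ≤ (bdry G (symmDiff S {v})).card := by
    apply econn_le
    · obtain ⟨u, hu, huv⟩ := Finset.exists_mem_ne (show 1 < S.card by omega) v
      exact ⟨u, Finset.mem_symmDiff.2 (Or.inl ⟨hu, by simpa using huv⟩)⟩
    · obtain ⟨u, hu, huv⟩ := Finset.exists_mem_ne (show 1 < Sᶜ.card by omega) v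
      intro h
      have h7 : u ∈ symmDiff S {v} := h ▸ Finset.mem_univ _
      rw [Finset.mem_symmDiff, Finset.mem_singleton] at h7
      rw [Finset.mem_compl] at hu
      tauto
  omega

lemma exp_neg_four_mul_le {x : ℝ} (h0 : 0 ≤ x) (h1 : x ≤ 3 / 4) :
    Real.exp (-(4 * x)) ≤ 1 - x := by
  have hpos : 0 < 1 - x := by linarith
  rw [← Real.le_log_iff_exp_le hpos]
  refine le_trans ?_ (Real.one_sub_inv_le_log_of_pos hpos)
  rw [neg_le_iff_add_nonneg, inv_eq_one_div]
  have : 1 - 1 / (1 - x) + 4 * x = x * (3 - 4 * x) / (1 - x) := by field_simp; ring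
  rw [this]
  apply div_nonneg _ hpos.le
  nlinarith

/-- A random 1-out subgraph avoids a given near-minimum cut with constant probability. -/
lemma exp_mul_prod_degree_le (hδ : 1 ≤ δ) (hd : ∀ v, δ ≤ G.degree v) (hδ' : econn G ≤ δ)
    (h1 : 2 ≤ S.card) (h2 : 2 ≤ Sᶜ.card) (h3 : 2 * (bdry G S).card < 3 * econn G) :
    Real.exp (-12) * ((∏ v, G.degree v : ℕ) : ℝ) ≤
      ((Fintype.piFinset fun v => (G.neighborFinset v).filter
        fun u => (u ∈ S ↔ v ∈ S)).card : ℝ) := by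
  have hc : ∀ v, (((G.neighborFinset v).filter fun u => (u ∈ S ↔ v ∈ S)).card : ℝ) =
      (G.degree v : ℝ) * (1 - cutDegree G S v / G.degree v) := by
    intro v
    have hdv : (0 : ℝ) < G.degree v := by exact_mod_cast hδ.trans (hd v)
    have := Finset.card_filter_add_card_filter_not (s := G.neighborFinset v)
      (fun u => (u ∈ S ↔ v ∈ S))
    rw [SimpleGraph.card_neighborFinset_eq_degree] at this
    rw [mul_sub, mul_one, mul_div_cancel₀ _ hdv.ne', ← this]
    unfold cutDegree
    push_cast
    ring
  rw [Fintype.card_piFinset]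
  push_cast
  simp only [hc]
  rw [Finset.prod_mul_distrib, mul_comm]
  apply mul_le_mul_of_nonneg_left _ (Finset.prod_nonneg fun _ _ => Nat.cast_nonneg _)
  have hδ0 : (0 : ℝ) < δ := by exact_mod_cast hδ
  have h4 : ∑ v, (cutDegree G S v : ℝ) / G.degree v ≤ 3 := by
    calc _ ≤ ∑ v, (cutDegree G S v : ℝ) / δ := by
          apply Finset.sum_le_sum
          intro v _
          exact div_le_div_of_nonneg_left (Nat.cast_nonneg _) hδ0 (by exact_mod_cast hd v)
      _ = ((2 * (bdry G S).card : ℕ) : ℝ) / δ := by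
          rw [← Finset.sum_div, ← sum_cutDegree]
          push_cast
          rfl
      _ ≤ _ := by
          rw [div_le_iff₀ hδ0]
          exact_mod_cast (by omega : 2 * (bdry G S).card ≤ 3 * δ)
  calc Real.exp (-12) ≤ Real.exp (∑ v, -(4 * ((cutDegree G S v : ℝ) / G.degree v))) := by
        apply Real.exp_le_exp.2
        rw [Finset.sum_neg_distrib, ← Finset.mul_sum]
        linarith
    _ = ∏ v, Real.exp (-(4 * ((cutDegree G S v : ℝ) / G.degree v))) := Real.exp_sum _ _
    _ ≤ _ := by
        apply Finset.prod_le_prod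
        · intro v _
          exact (Real.exp_pos _).le
        · intro v _
          apply exp_neg_four_mul_le
          · positivity
          · have hdv : (0 : ℝ) < G.degree v := by exact_mod_cast hδ.trans (hd v)
            rw [div_le_iff₀ hdv]
            have : (4 * cutDegree G S v : ℝ) ≤ 3 * G.degree v := by
              exact_mod_cast four_mul_cutDegree_le hδ hd h1 h2 h3 v
            linarith

end nearMinimum

/-- `u` and `v` are equivalent when no set that is a union of components of the functional
graph of `f` separates them. -/
def funSetoid {U : Type*} (f : U → U) : Setoid U where
  r u v := ∀ S : Finset U, (∀ x, f x ∈ S ↔ x ∈ S) → (u ∈ S ↔ v ∈ S)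
  iseqv := ⟨fun _ _ _ => Iff.rfl, fun h S hS => (h S hS).symm,
    fun h h' S hS => (h S hS).trans (h' S hS)⟩

lemma mk_apply {U : Type*} (f : U → U) (x : U) :
    Quotient.mk (funSetoid f) (f x) = Quotient.mk (funSetoid f) x :=
  Quotient.sound fun _ hS => hS x

lemma mk_iterate {U : Type*} (f : U → U) (x : U) (k : ℕ) :
    Quotient.mk (funSetoid f) (f^[k] x) = Quotient.mk (funSetoid f) x := by
  induction k with
  | zero => rfl
  | succ k ih => rw [Function.iterate_succ_apply', mk_apply, ih]

lemma exists_iterate_mem_periodicPts {U : Type*} [Finite U] (f : U → U) (x : U) :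
    ∃ k, f^[k] x ∈ Function.periodicPts f := by
  obtain ⟨i, j, hij, h⟩ := Finite.exists_ne_map_eq_of_infinite fun k => f^[k] x
  wlog hlt : i < j generalizing i j
  · exact this j i hij.symm h.symm (by omega)
  refine ⟨i, j - i, by omega, ?_⟩
  rw [Function.IsPeriodicPt, Function.IsFixedPt, ← Function.iterate_add_apply,
    Nat.sub_add_cancel hlt.le, h]

lemma minimalPeriod_le_card (f : V → V) (v : V) :
    Function.minimalPeriod f v ≤ Fintype.card V := by
  have h := Finset.card_le_card_of_injOn (s := Finset.range (Function.minimalPeriod f v))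
    (t := Finset.univ) (fun k => f^[k] v) (fun _ _ => Finset.mem_coe.2 (Finset.mem_univ _)) (by
      intro i hi j hj h
      rw [Finset.mem_coe, Finset.mem_range] at hi hj
      exact Function.iterate_injOn_Iio_minimalPeriod hi hj h)
  rwa [Finset.card_range, Finset.card_univ] at h

lemma card_quotient_funSetoid_le (f : V → V) :
    (Fintype.card (Quotient (funSetoid f)) : ℝ) ≤
      ∑ v, ((Function.minimalPeriod f v : ℕ) : ℝ)⁻¹ := by
  rw [← Finset.sum_fiberwise Finset.univ (Quotient.mk (funSetoid f)), ← Finset.card_univ,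
    Finset.card_eq_sum_ones]
  push_cast
  apply Finset.sum_le_sum
  intro q _
  obtain ⟨x, rfl⟩ := Quotient.exists_rep q
  obtain ⟨k, hk⟩ := exists_iterate_mem_periodicPts f x
  set p := f^[k] x with hp
  set m := Function.minimalPeriod f p with hm
  have hmpos : 0 < m := Function.minimalPeriod_pos_of_mem_periodicPts hk
  have hmem : ∀ i, Function.minimalPeriod f (f^[i] p) = m :=
    fun i => Function.minimalPeriod_apply_iterate hk i
  calc (1 : ℝ) = ∑ i ∈ Finset.range m, ((Function.minimalPeriod f (f^[i] p) : ℕ) : ℝ)⁻¹ := by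
        simp only [hmem, Finset.sum_const, Finset.card_range, nsmul_eq_mul]
        rw [mul_inv_cancel₀]
        exact_mod_cast hmpos.ne'
    _ = ∑ v ∈ (Finset.range m).image fun i => f^[i] p,
          ((Function.minimalPeriod f v : ℕ) : ℝ)⁻¹ := by
        rw [Finset.sum_image]
        intro i hi j hj h
        rw [Finset.mem_coe, Finset.mem_range] at hi hj
        exact Function.iterate_injOn_Iio_minimalPeriod hi hj h
    _ ≤ _ := by
        apply Finset.sum_le_sum_of_subset_of_nonneg
        · intro v hv
          obtain ⟨i, -, rfl⟩ := Finset.mem_image.1 hv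
          rw [Finset.mem_filter]
          refine ⟨Finset.mem_univ _, ?_⟩
          rw [mk_iterate, hp, mk_iterate]
        · intro v _ _
          positivity

/-- The functions assigning to each vertex one of its neighbours. -/
def neighborMaps (G : SimpleGraph V) : Finset (V → V) :=
  Fintype.piFinset fun v => G.neighborFinset v

lemma card_neighborMaps (G : SimpleGraph V) : (neighborMaps G).card = ∏ v, G.degree v := by
  simp [neighborMaps, Fintype.card_piFinset]

lemma card_minimalPeriod_eq_mul_le {G : SimpleGraph V} {δ : ℕ} (hd : ∀ v, δ ≤ G.degree v)
    (v : V) {l : ℕ} (hl : 1 ≤ l) :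
    ((neighborMaps G).filter fun f => Function.minimalPeriod f v = l).card * δ ≤
      (neighborMaps G).card := by
  set A := (neighborMaps G).filter fun f => Function.minimalPeriod f v = l with hA
  have hmem : ∀ f ∈ A, (∀ x, f x ∈ G.neighborFinset x) ∧ Function.minimalPeriod f v = l := by
    intro f hf
    simpa [hA, neighborMaps, Fintype.mem_piFinset] using hf
  calc A.card * δ ≤ (A.sigma fun f => G.neighborFinset (f^[l - 1] v)).card := by
        rw [Finset.card_sigma, ← smul_eq_mul]
        apply Finset.card_nsmul_le_sum
        intro f _
        rw [SimpleGraph.card_neighborFinset_eq_degree]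
        exact hd _
    _ ≤ _ := by
        apply Finset.card_le_card_of_injOn
          (fun e => Function.update e.1 (e.1^[l - 1] v) e.2)
        · rintro ⟨f, g⟩ h
          rw [Finset.mem_coe, Finset.mem_sigma] at h
          rw [Finset.mem_coe, neighborMaps, Fintype.mem_piFinset]
          intro x
          simp only at h ⊢
          by_cases hx : x = f^[l - 1] v
          · subst hx
            rw [Function.update_self]
            exact h.2
          · rw [Function.update_of_ne hx]
            exact (hmem f h.1).1 x
        · have hit : ∀ f ∈ A, ∀ g, ∀ i, i ≤ l - 1 →
              (Function.update f (f^[l - 1] v) g)^[i] v = f^[i] v := by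
            intro f hf g i
            induction i with
            | zero => intro _; rfl
            | succ i ih =>
              intro hi
              rw [Function.iterate_succ_apply', Function.iterate_succ_apply', ih (by omega),
                Function.update_of_ne]
              intro h
              have h1 := (hmem f hf).2
              have := Function.iterate_injOn_Iio_minimalPeriod (f := f) (x := v)
                (Set.mem_Iio.2 (by omega)) (Set.mem_Iio.2 (by omega)) h
              omega
          have hback : ∀ f ∈ A, ∀ g,
              Function.update (Function.update f (f^[l - 1] v) g) (f^[l - 1] v) v = f := by
            intro f hf g
            rw [Function.update_idem, Function.update_eq_self_iff,
              ← Function.iterate_succ_apply' f, Nat.succ_eq_add_one, Nat.sub_add_cancel hl,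
              ← (hmem f hf).2, Function.iterate_minimalPeriod]
          rintro ⟨f, g⟩ h ⟨f', g'⟩ h' heq
          rw [Finset.mem_coe, Finset.mem_sigma] at h h'
          simp only at heq h h'
          have h1 : f^[l - 1] v = f'^[l - 1] v := by
            rw [← hit f h.1 g _ le_rfl, ← hit f' h'.1 g' _ le_rfl, heq]
          have h2 : f = f' := by
            rw [← hback f h.1 g, ← hback f' h'.1 g', heq, h1]
          subst h2
          have h3 := congrFun heq (f^[l - 1] v)
          rw [Function.update_self, Function.update_self] at h3
          rw [h3]

/-- On average a random 1-out subgraph has few components. -/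
lemma sum_card_quotient_le {G : SimpleGraph V} {δ : ℕ} (hδ : 1 ≤ δ)
    (hd : ∀ v, δ ≤ G.degree v) :
    ∑ f ∈ neighborMaps G, (Fintype.card (Quotient (funSetoid f)) : ℝ) ≤
      (neighborMaps G).card * ((Fintype.card V : ℝ) / δ * (1 + Real.log (Fintype.card V))) := by
  have hδ0 : (0 : ℝ) < δ := by exact_mod_cast hδ
  have h1 : ∀ v, ∑ f ∈ neighborMaps G, ((Function.minimalPeriod f v : ℕ) : ℝ)⁻¹ ≤
      (neighborMaps G).card / δ * (1 + Real.log (Fintype.card V)) := by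
    intro v
    calc _ = ∑ l ∈ Finset.range (Fintype.card V + 1),
            ∑ f ∈ (neighborMaps G).filter fun f => Function.minimalPeriod f v = l,
              ((Function.minimalPeriod f v : ℕ) : ℝ)⁻¹ := by
          rw [Finset.sum_fiberwise_of_maps_to]
          intro f _
          rw [Finset.mem_range, Nat.lt_succ_iff]
          exact minimalPeriod_le_card f v
      _ = ∑ l ∈ Finset.range (Fintype.card V + 1),
            ((neighborMaps G).filter fun f => Function.minimalPeriod f v = l).card *
              ((l : ℕ) : ℝ)⁻¹ := by
          apply Finset.sum_congr rfl
          intro l _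
          rw [← nsmul_eq_mul, ← Finset.sum_const]
          apply Finset.sum_congr rfl
          intro f hf
          rw [(Finset.mem_filter.1 hf).2]
      _ ≤ ∑ l ∈ Finset.range (Fintype.card V + 1),
            (neighborMaps G).card / δ * ((l : ℕ) : ℝ)⁻¹ := by
          apply Finset.sum_le_sum
          intro l _
          rcases Nat.eq_zero_or_pos l with rfl | hl
          · simp
          · apply mul_le_mul_of_nonneg_right _ (by positivity)
            rw [le_div_iff₀ hδ0]
            exact_mod_cast card_minimalPeriod_eq_mul_le hd v hl
      _ ≤ _ := by
          rw [← Finset.mul_sum]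
          apply mul_le_mul_of_nonneg_left _ (by positivity)
          have := harmonic_le_one_add_log (Fintype.card V)
          rw [harmonic] at this
          push_cast at this
          rw [Finset.sum_range_succ']
          simpa using this
  calc _ ≤ ∑ f ∈ neighborMaps G, ∑ v, ((Function.minimalPeriod f v : ℕ) : ℝ)⁻¹ :=
        Finset.sum_le_sum fun f _ => card_quotient_funSetoid_le f
    _ = ∑ v, ∑ f ∈ neighborMaps G, ((Function.minimalPeriod f v : ℕ) : ℝ)⁻¹ := Finset.sum_comm
    _ ≤ ∑ v : V, ((neighborMaps G).card : ℝ) / δ * (1 + Real.log (Fintype.card V)) :=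
        Finset.sum_le_sum fun v _ => h1 v
    _ = _ := by
        rw [Finset.sum_const, Finset.card_univ, nsmul_eq_mul]
        ring

/-- Contracting along `q`: the weights induced on the quotient. -/
def pushWeight {W : Type*} (w : V → V → ℕ) (q : V → W) (a b : W) : ℕ :=
  ∑ u, ∑ v, if q u = a ∧ q v = b then w u v else 0

lemma cutWeight_pushWeight {W : Type*} [Fintype W] (w : V → V → ℕ) (q : V → W) (S : Finset W) :
    cutWeight (pushWeight w q) S = cutWeight w (Finset.univ.filter fun v => q v ∈ S) := by
  have h : ∀ g : W → W → ℕ, ∑ a, ∑ b, pushWeight w q a b * g a b =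
      ∑ u, ∑ v, w u v * g (q u) (q v) := by
    intro g
    calc _ = ∑ x : W × W, ∑ y : V × V,
          if (q y.1, q y.2) = x then w y.1 y.2 * g x.1 x.2 else 0 := by
          rw [Fintype.sum_prod_type]
          refine Finset.sum_congr rfl fun a _ => Finset.sum_congr rfl fun b _ => ?_
          rw [Fintype.sum_prod_type, pushWeight, Finset.sum_mul]
          refine Finset.sum_congr rfl fun u _ => ?_
          rw [Finset.sum_mul]
          refine Finset.sum_congr rfl fun v _ => ?_
          rw [ite_mul, zero_mul]
          exact if_congr Prod.mk_inj.symm rfl rfl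
      _ = _ := by
          rw [Finset.sum_comm, Fintype.sum_prod_type]
          refine Finset.sum_congr rfl fun u _ => Finset.sum_congr rfl fun v _ => ?_
          rw [Finset.sum_ite_eq]
          simp
  unfold cutWeight
  rw [h fun a b => if (a ∈ S ↔ b ∈ S) then 0 else 1]
  simp

/-- The number of near-minimum cuts which are unions of components of the functional graph
of `f`. -/
lemma card_saturated_le (G : SimpleGraph V) (f : V → V) (r : V) :
    (Finset.univ.filter fun S : Finset V => (r ∉ S ∧ S.Nonempty ∧
        2 * (bdry G S).card < 3 * econn G) ∧ ∀ x, f x ∈ S ↔ x ∈ S).card ≤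
      3 * (Fintype.card (Quotient (funSetoid f)) ^ 2 *
        (28 * (Nat.log 2 (Fintype.card (Quotient (funSetoid f))) + 3))) *
        (Nat.log 2 (3 * (2 * econn G)) + 1) := by
  let q : V → Quotient (funSetoid f) := Quotient.mk (funSetoid f)
  have hq : Function.Surjective q := Quotient.exists_rep
  have hcut : ∀ S, cutWeight (pushWeight (adjWeight G) q) S =
      2 * (bdry G (Finset.univ.filter fun v => q v ∈ S)).card := by
    intro S
    rw [cutWeight_pushWeight, cutWeight_adjWeight_eq]
    congr!
  refine le_trans ?_ (card_cuts_le (pushWeight (adjWeight G) q) (L := 2 * econn G) ?_ (q r))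
  · have hpre : ∀ S : Finset V, (∀ x, f x ∈ S ↔ x ∈ S) → ∀ v, q v ∈ S.image q ↔ v ∈ S := by
      intro S hS v
      constructor
      · intro h
        obtain ⟨u, hu, huv⟩ := Finset.mem_image.1 h
        exact (Quotient.exact huv S hS).1 hu
      · exact fun h => Finset.mem_image_of_mem q h
    apply Finset.card_le_card_of_injOn fun S => S.image q
    · intro S hS
      simp only [Finset.coe_filter, Finset.mem_univ, true_and, Set.mem_ofPred_eq] at hS ⊢
      obtain ⟨⟨h1, h2, h3⟩, h4⟩ := hS
      refine ⟨by rwa [hpre S h4], h2.image q, ?_⟩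
      rw [hcut]
      have : (Finset.univ.filter fun v => q v ∈ S.image q) = S := by
        ext v; simp only [Finset.mem_filter, Finset.mem_univ, true_and, hpre S h4]
      rw [this]
      omega
    · intro S hS S' hS' h
      simp only [Finset.coe_filter, Finset.mem_univ, true_and, Set.mem_ofPred_eq] at hS hS' h
      ext v
      rw [← hpre S hS.2, ← hpre S' hS'.2, h]
  · intro S hS hS'
    rw [hcut]
    apply Nat.mul_le_mul_left
    apply econn_le
    · obtain ⟨a, ha⟩ := hS
      obtain ⟨v, rfl⟩ := hq a
      exact ⟨v, by simpa using ha⟩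
    · intro h
      apply hS'
      rw [Finset.eq_univ_iff_forall] at h ⊢
      intro a
      obtain ⟨v, rfl⟩ := hq a
      exact (Finset.mem_filter.1 (h v)).2

lemma natLog_two_le {a : ℕ} (ha : 1 ≤ a) : (Nat.log 2 a : ℝ) ≤ 2 * Real.log a := by
  have h1 : ((2 : ℝ)) ^ Nat.log 2 a ≤ a := by
    exact_mod_cast Nat.pow_log_le_self 2 (by omega)
  have h2 := Real.log_le_log (by positivity) h1
  rw [Real.log_pow] at h2
  have h3 := Real.log_two_gt_d9
  have h4 : (0 : ℝ) ≤ Nat.log 2 a := Nat.cast_nonneg _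
  nlinarith

lemma one_le_log_add_two {n : ℕ} (hn : 1 ≤ n) : 1 ≤ Real.log ((n : ℝ) + 2) := by
  have h1 : (1 : ℝ) ≤ n := by exact_mod_cast hn
  rw [Real.le_log_iff_exp_le (by linarith)]
  have := Real.exp_one_lt_d9
  linarith

/-- Numerical form of the bound for one contracted graph. -/
lemma core_bound_le {N n l : ℕ} (hn : 1 ≤ n) (hN : N ≤ n) (hl : l ≤ n) {M : ℝ} (hM : (N : ℝ) ≤ M) :
    ((3 * (N ^ 2 * (28 * (Nat.log 2 N + 3))) * (Nat.log 2 (3 * (2 * l)) + 1) : ℕ) : ℝ) ≤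
      3780 * M ^ 2 * Real.log ((n : ℝ) + 2) ^ 2 := by
  set x := Real.log ((n : ℝ) + 2) with hx
  have hx1 : 1 ≤ x := one_le_log_add_two hn
  have hn1 : (1 : ℝ) ≤ n := by exact_mod_cast hn
  have hlog : Real.log n ≤ x := Real.log_le_log (by linarith) (by linarith)
  have h1 : (Nat.log 2 N : ℝ) + 3 ≤ 5 * x := by
    have h2 : (Nat.log 2 N : ℝ) ≤ Nat.log 2 n := by exact_mod_cast Nat.log_mono_right hN
    have := natLog_two_le hn
    linarith
  have h2 : (Nat.log 2 (3 * (2 * l)) : ℝ) + 1 ≤ 9 * x := by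
    have h3 : (Nat.log 2 (3 * (2 * l)) : ℝ) ≤ Nat.log 2 (8 * n) := by
      exact_mod_cast Nat.log_mono_right (by omega)
    have h4 := natLog_two_le (a := 8 * n) (by omega)
    push_cast at h4
    rw [Real.log_mul (by norm_num) (by linarith), show (8 : ℝ) = 2 ^ 3 by norm_num,
      Real.log_pow] at h4
    have h5 := Real.log_two_lt_d9
    push_cast at h4
    linarith
  have h3 : (N : ℝ) ^ 2 ≤ M ^ 2 := pow_le_pow_left₀ (Nat.cast_nonneg _) hM 2
  push_cast
  calc 3 * ((N : ℝ) ^ 2 * (28 * ((Nat.log 2 N : ℝ) + 3))) *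
        ((Nat.log 2 (3 * (2 * l)) : ℝ) + 1)
      ≤ 3 * (M ^ 2 * (28 * (5 * x))) * (9 * x) := by gcongr
    _ = _ := by ring

/-- The number of near-minimum cuts with both sides nontrivial, counted by the side avoiding a
fixed vertex. -/
lemma card_rooted_cuts_le {G : SimpleGraph V} {δ : ℕ} (hδ : 1 ≤ δ)
    (hd : ∀ v, δ ≤ G.degree v) (hδ' : econn G ≤ δ) (r : V) :
    ((Finset.univ.filter fun S : Finset V =>
        r ∉ S ∧ 2 ≤ S.card ∧ 2 ≤ Sᶜ.card ∧ 2 * (bdry G S).card < 3 * econn G).card : ℝ) ≤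
      120960 / Real.exp (-12) ^ 3 * ((Fintype.card V : ℝ) / δ) ^ 2 *
        Real.log ((Fintype.card V : ℝ) + 2) ^ 4 := by
  set X := Finset.univ.filter fun S : Finset V =>
        r ∉ S ∧ 2 ≤ S.card ∧ 2 ≤ Sᶜ.card ∧ 2 * (bdry G S).card < 3 * econn G with hX
  have hmem : ∀ S ∈ X, r ∉ S ∧ 2 ≤ S.card ∧ 2 ≤ Sᶜ.card ∧ 2 * (bdry G S).card < 3 * econn G :=
    fun S hS => (Finset.mem_filter.1 hS).2
  set n := Fintype.card V with hn
  have hn1 : 1 ≤ n := Fintype.card_pos_iff.2 ⟨r⟩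
  have hn1' : (1 : ℝ) ≤ n := by exact_mod_cast hn1
  have hδn : δ ≤ n := (hd r).trans (G.degree_lt_card_verts r).le
  have hδ0 : (0 : ℝ) < δ := by exact_mod_cast hδ
  set x := Real.log ((n : ℝ) + 2) with hx
  have hx1 : 1 ≤ x := one_le_log_add_two hn1
  have hlog : Real.log n ≤ x := Real.log_le_log (by linarith) (by linarith)
  have hlog0 : 0 ≤ Real.log n := Real.log_nonneg hn1'
  set E := Real.exp (-12) with hE
  have hE0 : 0 < E := Real.exp_pos _
  set ρ := (n : ℝ) / δ with hρ
  have hρ0 : 0 < ρ := div_pos (by linarith) hδ0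
  set Ω := neighborMaps G with hΩ
  have hω : (0 : ℝ) < Ω.card := by
    have : 0 < Ω.card := by
      rw [hΩ, card_neighborMaps]
      exact Finset.prod_pos fun v _ => hδ.trans (hd v)
    exact_mod_cast this
  let N : (V → V) → ℕ := fun f => Fintype.card (Quotient (funSetoid f))
  set M := 2 / E * (ρ * (1 + Real.log n)) with hM
  have hM0 : 0 < M := by positivity
  have hMx : M ≤ 4 / E * ρ * x := by
    have : M = 2 / E * ρ * (1 + Real.log n) := by rw [hM]; ring
    rw [this]
    calc 2 / E * ρ * (1 + Real.log n) ≤ 2 / E * ρ * (2 * x) := by gcongr; linarith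
      _ = _ := by ring
  have hmarkov : ((Ω.filter fun f => ¬ (N f : ℝ) ≤ M).card : ℝ) ≤ E / 2 * Ω.card := by
    have h1 : ((Ω.filter fun f => ¬ (N f : ℝ) ≤ M).card : ℝ) * M ≤ ∑ f ∈ Ω, (N f : ℝ) := by
      rw [← nsmul_eq_mul]
      refine (Finset.card_nsmul_le_sum _ (fun f => (N f : ℝ)) M ?_).trans
        (Finset.sum_le_sum_of_subset_of_nonneg (Finset.filter_subset _ _)
          fun _ _ _ => Nat.cast_nonneg _)
      intro f hf
      exact (not_le.1 (Finset.mem_filter.1 hf).2).le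
    have h2 := h1.trans (sum_card_quotient_le hδ hd)
    have h3 : (Ω.card : ℝ) * (ρ * (1 + Real.log n)) = E / 2 * Ω.card * M := by
      rw [hM]; field_simp
    rw [← hΩ, ← hn, ← hρ, h3] at h2
    exact le_of_mul_le_mul_right h2 hM0
  set Gd := Ω.filter fun f => (N f : ℝ) ≤ M with hGd
  have hsurv : ∀ S ∈ X, E / 2 * Ω.card ≤ ((Gd.filter fun f => ∀ y, f y ∈ S ↔ y ∈ S).card : ℝ) := by
    intro S hS
    obtain ⟨-, h1, h2, h3⟩ := hmem S hS
    have h4 := exp_mul_prod_degree_le hδ hd hδ' h1 h2 h3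
    rw [← card_neighborMaps, ← hΩ, ← hE] at h4
    have h5 : (Fintype.piFinset fun v => (G.neighborFinset v).filter
        fun u => (u ∈ S ↔ v ∈ S)).card ≤ (Gd.filter fun f => ∀ y, f y ∈ S ↔ y ∈ S).card +
          (Ω.filter fun f => ¬ (N f : ℝ) ≤ M).card := by
      refine le_trans (Finset.card_le_card ?_) (Finset.card_union_le _ _)
      intro f hf
      simp only [Fintype.mem_piFinset, Finset.mem_filter] at hf
      have hfΩ : f ∈ Ω := Fintype.mem_piFinset.2 fun v => (hf v).1
      simp only [Finset.mem_union, Finset.mem_filter, hGd]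
      have := fun v => (hf v).2
      tauto
    have h6 : ((Fintype.piFinset fun v => (G.neighborFinset v).filter
        fun u => (u ∈ S ↔ v ∈ S)).card : ℝ) ≤
          ((Gd.filter fun f => ∀ y, f y ∈ S ↔ y ∈ S).card : ℝ) +
          ((Ω.filter fun f => ¬ (N f : ℝ) ≤ M).card : ℝ) := by exact_mod_cast h5
    linarith
  have hcore : ∀ f ∈ Gd, ((X.filter fun S => ∀ y, f y ∈ S ↔ y ∈ S).card : ℝ) ≤
      3780 * M ^ 2 * x ^ 2 := by
    intro f hf
    refine le_trans ?_ (core_bound_le hn1 (Fintype.card_quotient_le (funSetoid f))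
      (hδ'.trans hδn) (Finset.mem_filter.1 hf).2)
    have h1 := card_saturated_le G f r
    refine le_trans ?_ (Nat.cast_le.2 h1)
    rw [Nat.cast_le]
    apply Finset.card_le_card
    intro S hS
    rw [Finset.mem_filter] at hS
    obtain ⟨h2, h3, -, h4⟩ := hmem S hS.1
    exact Finset.mem_filter.2 ⟨Finset.mem_univ _,
      ⟨h2, Finset.card_pos.1 (by omega), h4⟩, hS.2⟩
  have hdouble : ∑ S ∈ X, ((Gd.filter fun f => ∀ y, f y ∈ S ↔ y ∈ S).card : ℝ) =
      ∑ f ∈ Gd, ((X.filter fun S => ∀ y, f y ∈ S ↔ y ∈ S).card : ℝ) := by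
    simp only [Finset.card_filter]
    push_cast
    exact Finset.sum_comm
  have h1 : (X.card : ℝ) * (E / 2 * Ω.card) ≤ Ω.card * (3780 * M ^ 2 * x ^ 2) := by
    calc (X.card : ℝ) * (E / 2 * Ω.card) ≤
          ∑ S ∈ X, ((Gd.filter fun f => ∀ y, f y ∈ S ↔ y ∈ S).card : ℝ) := by
          rw [← nsmul_eq_mul]
          exact Finset.card_nsmul_le_sum _ _ _ hsurv
      _ ≤ Gd.card * (3780 * M ^ 2 * x ^ 2) := by
          rw [hdouble, ← nsmul_eq_mul]
          exact Finset.sum_le_card_nsmul _ _ _ hcore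
      _ ≤ _ := by
          gcongr
          exact Finset.filter_subset _ _
  have h2 : (X.card : ℝ) * (E / 2) ≤ 3780 * M ^ 2 * x ^ 2 := by
    refine le_of_mul_le_mul_right ?_ hω
    linarith
  have h3 : (X.card : ℝ) * (E / 2) ≤ 3780 * (4 / E * ρ * x) ^ 2 * x ^ 2 := by
    refine h2.trans ?_
    gcongr
  have h4 : 120960 / E ^ 3 * ρ ^ 2 * x ^ 4 =
      3780 * (4 / E * ρ * x) ^ 2 * x ^ 2 / (E / 2) := by
    field_simp
    ring
  rw [h4, le_div_iff₀ (by positivity)]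
  exact h3

theorem stmt3 :
    ∃ C c : ℝ, 0 < C ∧ 1 ≤ c ∧
      ∀ (V : Type) [Fintype V], ∀ (G : SimpleGraph V) (n δ : ℕ),
        G.Connected →
        n = Fintype.card V →
        δ = G.minDegree →
        1 ≤ δ →
        (((Finset.univ.filter fun S : Finset V =>
              2 ≤ S.card ∧ 2 ≤ Sᶜ.card ∧ 2 * (bdry G S).card < 3 * econn G).image
            fun S => ({S, Sᶜ} : Finset (Finset V))).card : ℝ) ≤
          C * ((n : ℝ) / (δ : ℝ)) ^ 2 * Real.log ((n : ℝ) + 2) ^ c := by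
  refine ⟨120960 / Real.exp (-12) ^ 3, (4 : ℕ), by positivity, by norm_num, ?_⟩
  intro V _ G n δ hG hn hδ hδ1
  have hne : Nonempty V := hG.nonempty
  obtain ⟨r⟩ := id hne
  have hd : ∀ v, δ ≤ G.degree v := fun v => hδ ▸ G.minDegree_le_degree v
  obtain ⟨v, hv⟩ := G.exists_minimal_degree_vertex
  have hδ' : econn G ≤ δ := by
    rw [hδ, hv]
    exact econn_le_degree G (hδ1.trans (hd v))
  rw [Real.rpow_natCast, hn]
  refine le_trans ?_ (card_rooted_cuts_le hδ1 hd hδ' r)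
  rw [Nat.cast_le]
  refine le_trans (Finset.card_le_card ?_)
    (Finset.card_image_le (f := fun S => ({S, Sᶜ} : Finset (Finset V))))
  intro P hP
  obtain ⟨S, hS, rfl⟩ := Finset.mem_image.1 hP
  obtain ⟨-, h1, h2, h3⟩ := Finset.mem_filter.1 hS
  rw [Finset.mem_image]
  by_cases hr : r ∈ S
  · refine ⟨Sᶜ, Finset.mem_filter.2 ⟨Finset.mem_univ _, by simpa using hr, h2, ?_, ?_⟩, ?_⟩
    · rwa [compl_compl]
    · rwa [bdry_compl]
    · rw [compl_compl, Finset.pair_comm]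
  · exact ⟨S, Finset.mem_filter.2 ⟨Finset.mem_univ _, hr, h1, h2, h3⟩, rfl⟩

end
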